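/- Let N be a nonnegative integer, let η be purely imaginary with |η| < τ/(2(N+1)i), and let a = (a₁,a₂,a₃,a₄) ∈ ℂ⁴ with a₁+a₂+a₃+a₄ = 0. Then for all f, g ∈ Θ_N one has ⟨Δ(a)f, g⟩ = ⟨f, σ(Δ(ā)(σg))⟩, where ā = (conj(a₁), conj(a₂), conj(a₃), conj(a₄)); that is, the adjoint of Δ(a) with respect to the Sklyanin pairing is σ∘Δ(ā)∘σ. -/

import Mathlib

noncomputable section
open Complex MeasureTheory

def cπ : ℂ := Real.pi

/-- Jacobi's first theta function θ₁(x|τ). -/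
def θf (τ x : ℂ) : ℂ :=
  I * ∑' n : ℤ, (-1 : ℂ) ^ n *
    Complex.exp (cπ * I * τ * ((n : ℂ) - 1/2)^2 + cπ * I * (2*(n : ℂ) - 1) * x)

/-- The space Θ_N of even theta functions of order 2N. -/
def ThetaSp (τ : ℂ) (N : ℕ) (f : ℂ → ℂ) : Prop :=
  Differentiable ℂ f ∧ (∀ x, f (x + 1) = f x) ∧
  (∀ x, f (x + τ) = Complex.exp (-2*cπ*I*N*(2*x + τ)) * f x) ∧
  (∀ x, f (-x) = f x)

/-- Sklyanin's weight function M(u,v). -/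
def Mw (τ η : ℂ) (N : ℕ) (u v : ℂ) : ℂ :=
  θf τ (2*u) * θf τ (2*v) /
    (Complex.exp (2*cπ*I*u*(N+2)) *
      ∏ k ∈ Finset.range (N+2),
        (θf τ (u + v + (2*(k:ℂ) - N - 1)*η + 1/2 + τ/2) *
         θf τ (u - v + (2*(k:ℂ) - N - 1)*η + 1/2 + τ/2)))

/-- Sklyanin's invariant pairing, with τ = t * I. -/
def pairing (τ η : ℂ) (t : ℝ) (N : ℕ) (f g : ℂ → ℂ) : ℂ :=
  ∫ y in (0:ℝ)..t, ∫ x in (0:ℝ)..(1:ℝ),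
    f (x + y*I) * (starRingEnd ℂ) (g (x + y*I)) *
      Mw τ η N (x + y*I) ((starRingEnd ℂ) (x + y*I))

/-- The numerator defining the difference operator Δ(a). -/
def ΔRHS (τ η : ℂ) (N : ℕ) (a₁ a₂ a₃ a₄ : ℂ) (f : ℂ → ℂ) (x : ℂ) : ℂ :=
  θf τ (x + a₁ - N*η/2) * θf τ (x + a₂ - N*η/2) * θf τ (x + a₃ - N*η/2) *
    θf τ (x + a₄ - N*η/2) * f (x + η)
  - θf τ (x - a₁ + N*η/2) * θf τ (x - a₂ + N*η/2) * θf τ (x - a₃ + N*η/2) *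
    θf τ (x - a₄ + N*η/2) * f (x - η)

/-- The involution σ on Θ_N. -/
def σop (τ : ℂ) (N : ℕ) (f : ℂ → ℂ) (x : ℂ) : ℂ :=
  Complex.exp (2*cπ*I*N*(1/4 + τ/4 + x)) * f (x + 1/2 + τ/2)

/-- q-Pochhammer infinite product (a;p)_∞. -/
def qPoch (a p : ℂ) : ℂ := ∏' j : ℕ, (1 - a * p^j)

/-- The constant C of Theorem 3.2. -/
def Cconst (τ η : ℂ) (N : ℕ) : ℂ :=
  2*η * Complex.exp (2*cπ*I*τ*(3/8)) /
    (θf τ (2*(N+1)*η) *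
      (qPoch (Complex.exp (2*cπ*I*τ)) (Complex.exp (2*cπ*I*τ)))^3)

/-- The kernel K(u,w). -/
def Kk (τ η : ℂ) (N : ℕ) (u w : ℂ) : ℂ :=
  Complex.exp (2*cπ*I*u*(N:ℂ)) *
  ∏ k ∈ Finset.range N,
    (θf τ (u + w + (2*(k:ℂ) - N + 1)*η + 1/2 + τ/2) *
     θf τ (u - w + (2*(k:ℂ) - N + 1)*η + 1/2 + τ/2))

/-- The basis functions e_k^N(x;a,b). -/
def ekN (τ η : ℂ) (N k : ℕ) (a b : ℂ) (x : ℂ) : ℂ :=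
  (∏ j ∈ Finset.range k, (θf τ (a + x + 2*(j:ℂ)*η) * θf τ (a - x + 2*(j:ℂ)*η))) *
  (∏ j ∈ Finset.range (N - k), (θf τ (b + x + 2*(j:ℂ)*η) * θf τ (b - x + 2*(j:ℂ)*η)))

/-- Elliptic number [x] = θ(2ηx). -/
def ell (τ η x : ℂ) : ℂ := θf τ (2*η*x)

/-- Elliptic shifted factorial [x]_k. -/
def ellFac (τ η x : ℂ) (k : ℕ) : ℂ := ∏ j ∈ Finset.range k, ell τ η (x + j)


def Jf (τ x : ℂ) : ℂ := jacobiTheta₂ x τ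

theorem θf_eq_J (τ x : ℂ) :
    θf τ x = I * Complex.exp (cπ*I*τ/4 - cπ*I*x) * Jf τ (x - τ/2 + 1/2) := by
  unfold θf Jf jacobiTheta₂ jacobiTheta₂_term cπ
  rw [mul_assoc I (Complex.exp _)]
  congr 1
  rw [← tsum_mul_left]
  apply tsum_congr
  intro n
  have h : (-1:ℂ)^n = Complex.exp (n * (Real.pi * I)) := by
    rw [Complex.exp_int_mul, Complex.exp_pi_mul_I]
  rw [h, ← Complex.exp_add, ← Complex.exp_add]
  congr 1; ring

theorem exp_two_pi : Complex.exp (2*cπ*I) = 1 := Complex.exp_two_pi_mul_I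

theorem exp_pi' : Complex.exp (cπ*I) = -1 := Complex.exp_pi_mul_I

theorem exp_pi_half : Complex.exp (cπ*I/2) = I := by
  refine Eq.trans ?_ Complex.exp_pi_div_two_mul_I
  unfold cπ; congr 1; ring

theorem J_add_one (τ x : ℂ) : Jf τ (x+1) = Jf τ x := jacobiTheta₂_add_left x τ
theorem J_add_tau (τ x : ℂ) : Jf τ (x+τ) = Complex.exp (-cπ*I*(τ+2*x)) * Jf τ x :=
  jacobiTheta₂_add_left' x τ
theorem J_neg (τ x : ℂ) : Jf τ (-x) = Jf τ x := jacobiTheta₂_neg_left x τ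
theorem J_diff {τ : ℂ} (h : 0 < τ.im) : Differentiable ℂ (Jf τ) :=
  fun x => differentiableAt_jacobiTheta₂_fst x h

theorem θ_diff {τ : ℂ} (h : 0 < τ.im) : Differentiable ℂ (θf τ) := by
  have : θf τ = fun x => I * Complex.exp (cπ*I*τ/4 - cπ*I*x) * Jf τ (x - τ/2 + 1/2) :=
    funext (θf_eq_J τ)
  rw [this]
  have := J_diff h
  fun_prop

theorem θ_add_half (τ x : ℂ) :
    θf τ (x+1/2+τ/2) = Complex.exp (-cπ*I*τ/4 - cπ*I*x) * Jf τ x := by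
  rw [θf_eq_J, show x+1/2+τ/2-τ/2+1/2 = x+1 by ring, J_add_one,
    show cπ*I*τ/4 - cπ*I*(x+1/2+τ/2) = (-cπ*I*τ/4 - cπ*I*x) - cπ*I/2 by ring, Complex.exp_sub,
    exp_pi_half]
  field_simp

theorem θ_add_one (τ x : ℂ) : θf τ (x+1) = - θf τ x := by
  rw [θf_eq_J, θf_eq_J, show x+1-τ/2+1/2 = (x-τ/2+1/2)+1 by ring, J_add_one,
    show cπ*I*τ/4 - cπ*I*(x+1) = (cπ*I*τ/4 - cπ*I*x) - cπ*I by ring, Complex.exp_sub, exp_pi']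
  ring

theorem θ_add_tau (τ x : ℂ) :
    θf τ (x+τ) = - (Complex.exp (-cπ*I*(τ+2*x)) * θf τ x) := by
  rw [θf_eq_J, θf_eq_J, show x+τ-τ/2+1/2 = (x-τ/2+1/2)+τ by ring, J_add_tau]
  have : Complex.exp (cπ*I*τ/4 - cπ*I*(x+τ)) * Complex.exp (-cπ*I*(τ+2*(x-τ/2+1/2)))
     = - (Complex.exp (-cπ*I*(τ+2*x)) * Complex.exp (cπ*I*τ/4 - cπ*I*x)) := by
    rw [← Complex.exp_add, ← Complex.exp_add, show cπ*I*τ/4 - cπ*I*(x+τ) + -cπ*I*(τ+2*(x-τ/2+1/2)) =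
      (-cπ*I*(τ+2*x)+(cπ*I*τ/4 - cπ*I*x)) - cπ*I by ring, Complex.exp_sub, exp_pi']
    ring
  linear_combination (I * Jf τ (x-τ/2+1/2)) * this

theorem θ_neg (τ x : ℂ) : θf τ (-x) = - θf τ x := by
  rw [θf_eq_J, θf_eq_J]
  have h1 := J_add_tau τ (x-τ/2-1/2)
  rw [show x-τ/2-1/2+τ = -(-x-τ/2+1/2) by ring, J_neg] at h1
  have h2 := J_add_one τ (x-τ/2-1/2)
  rw [show x-τ/2-1/2+1 = x-τ/2+1/2 by ring] at h2
  rw [h1, h2]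
  have : Complex.exp (cπ*I*τ/4 - cπ*I*(-x)) * Complex.exp (-cπ*I*(τ+2*(x-τ/2-1/2)))
     = - (Complex.exp (cπ*I*τ/4 - cπ*I*x)) := by
    rw [← Complex.exp_add, show cπ*I*τ/4 - cπ*I*(-x) + -cπ*I*(τ+2*(x-τ/2-1/2)) =
      (cπ*I*τ/4 - cπ*I*x) + cπ*I by ring, Complex.exp_add, exp_pi']
    ring
  linear_combination (I * Jf τ (x-τ/2-1/2)) * this

theorem θ_zero (τ : ℂ) : θf τ 0 = 0 := by
  have := θ_neg τ 0
  rw [neg_zero] at this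
  linear_combination this/2

theorem J_add_half (τ x : ℂ) :
    Jf τ (x+1/2+τ/2) = I * (Complex.exp (-cπ*I*τ/4 - cπ*I*x) * θf τ x) := by
  have h := θ_add_half τ (x+1/2+τ/2)
  rw [show x+1/2+τ/2+1/2+τ/2 = (x+τ)+1 by ring, θ_add_one, θ_add_tau, neg_neg] at h
  have e1 : Complex.exp (-cπ*I*τ/4 - cπ*I*(x+1/2+τ/2)) * Complex.exp (cπ*I*τ/4 + cπ*I*(x+1/2+τ/2)) = 1 := by
    rw [← Complex.exp_add, ← Complex.exp_zero]; congr 1; ring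
  have e2 : Complex.exp (-cπ*I*(τ+2*x)) * Complex.exp (cπ*I*τ/4 + cπ*I*(x+1/2+τ/2)) =
     I * Complex.exp (-cπ*I*τ/4 - cπ*I*x) := by
    nth_rw 4 [← exp_pi_half]
    rw [← Complex.exp_add, ← Complex.exp_add]; congr 1; ring
  linear_combination Complex.exp (cπ*I*τ/4 + cπ*I*(x+1/2+τ/2)) * (-h) - Jf τ (x+1/2+τ/2) * e1
    + θf τ x * e2

/-! Divisibility and Liouville -/

theorem entire_div (P H : ℂ → ℂ) (hP : Differentiable ℂ P) (hH : Differentiable ℂ H)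
    (h : ∀ z, H z = 0 → P z = 0 ∧ deriv H z ≠ 0) :
    ∃ G : ℂ → ℂ, Differentiable ℂ G ∧ ∀ z, P z = G z * H z := by
  classical
  refine ⟨fun z => if H z = 0 then deriv P z / deriv H z else P z / H z, ?_, ?_⟩
  · intro z
    by_cases hz : H z = 0
    · obtain ⟨p0, d0⟩ := h z hz
      have cP : DifferentiableAt ℂ (dslope P z) z :=
        ((Complex.differentiableOn_dslope (Filter.univ_mem)).2 hP.differentiableOn).differentiableAt
          Filter.univ_mem
      have cH : DifferentiableAt ℂ (dslope H z) z :=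
        ((Complex.differentiableOn_dslope (Filter.univ_mem)).2 hH.differentiableOn).differentiableAt
          Filter.univ_mem
      have n0 : dslope H z z ≠ 0 := by rwa [dslope_same]
      refine (cP.div cH n0).congr_of_eventuallyEq ?_
      filter_upwards [cH.continuousAt.eventually_ne n0] with w hw
      by_cases hwz : w = z
      · subst hwz
        simp [hz]
      · have e1 : H w = (w - z) * dslope H z w := by
          rw [dslope_of_ne _ hwz, slope_def_field, hz]; field_simp [sub_ne_zero.2 hwz]; ring
        have e2 : P w = (w - z) * dslope P z w := by
          rw [dslope_of_ne _ hwz, slope_def_field, p0]; field_simp [sub_ne_zero.2 hwz]; ring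
        have n1 := sub_ne_zero.2 hwz
        have n2 : H w ≠ 0 := by rw [e1]; exact mul_ne_zero n1 hw
        simp only [n2, if_false, Pi.div_apply]
        rw [e1, e2, mul_div_mul_left _ _ n1]
    · refine ((hP z).div (hH z) hz).congr_of_eventuallyEq ?_
      filter_upwards [(hH z).continuousAt.eventually_ne hz] with w hw
      simp [hw]
  · intro z
    by_cases hz : H z = 0
    · simp [hz, (h z hz).1]
    · simp [hz]

theorem entire_cancel (G H : ℂ → ℂ) (hG : Differentiable ℂ G) (hH : Differentiable ℂ H)
    (h : ∀ z, G z * H z = 0) (z₀ : ℂ) (hz : H z₀ ≠ 0) : ∀ z, G z = 0 := by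
  have aG : AnalyticOnNhd ℂ G Set.univ := fun z _ => hG.analyticAt z
  have h0 : ∀ᶠ z in nhds z₀, G z = 0 := by
    filter_upwards [(hH z₀).continuousAt.eventually_ne hz] with w hw
    exact (mul_eq_zero.1 (h w)).resolve_right hw
  intro z
  exact aG.eqOn_zero_of_preconnected_of_eventuallyEq_zero isPreconnected_univ (Set.mem_univ z₀) h0
    (Set.mem_univ z)

theorem liouville_elliptic {τ : ℂ} (hτ : 0 < τ.im) (G : ℂ → ℂ) (hG : Differentiable ℂ G)
    (h1 : ∀ z, G (z+1) = G z) (h2 : ∀ z, G (z+τ) = G z) (z w : ℂ) : G z = G w := by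
  apply hG.apply_eq_apply_of_bounded
  have hc : IsCompact (Set.image (fun q : ℝ × ℝ => G (q.1 + q.2 * τ)) (Set.Icc 0 1 ×ˢ Set.Icc 0 1)) := by
    apply (isCompact_Icc.prod isCompact_Icc).image
    have := hG.continuous
    fun_prop
  refine hc.isBounded.subset ?_
  rintro _ ⟨z, rfl⟩
  have p1 : ∀ (n : ℤ) z, G (z + n) = G z := fun n z => by
    have : Function.Periodic G 1 := h1
    simpa using this.int_mul n z
  have p2 : ∀ (n : ℤ) z, G (z + n*τ) = G z := fun n z => by
    have : Function.Periodic G τ := h2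
    simpa using this.int_mul n z
  set b : ℝ := z.im / τ.im
  set a : ℝ := (z - b*τ).re
  have hz : z = a + b*τ := by
    apply Complex.ext
    · simp [a]
    · simp [b]; field_simp
  refine ⟨(Int.fract a, Int.fract b), ⟨⟨Int.fract_nonneg _, (Int.fract_lt_one _).le⟩,
    ⟨Int.fract_nonneg _, (Int.fract_lt_one _).le⟩⟩, ?_⟩
  simp only
  rw [← p1 ⌊a⌋, ← p2 ⌊b⌋]
  congr 1
  rw [hz]
  have ea : (a:ℂ) = (⌊a⌋:ℂ) + (Int.fract a : ℝ) := by exact_mod_cast (Int.floor_add_fract a).symm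
  have eb : (b:ℂ) = (⌊b⌋:ℂ) + (Int.fract b : ℝ) := by exact_mod_cast (Int.floor_add_fract b).symm
  linear_combination -ea - τ * eb

/-! The product representation -/

def Ap (p w : ℂ) : ℂ := ∏' j : ℕ, (1 + -(w * p^j))

theorem Ap_summable {p : ℂ} (hp : ‖p‖ < 1) (w : ℂ) : Summable (fun j : ℕ => ‖-(w * p^j)‖) := by
  simp only [norm_neg, norm_mul, norm_pow]
  exact (summable_geometric_of_lt_one (norm_nonneg _) hp).mul_left _

theorem Ap_succ {p : ℂ} (hp : ‖p‖ < 1) (w : ℂ) : Ap p w = (1 - w) * Ap p (p*w) := by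
  unfold Ap
  have hm : Multipliable (fun n : ℕ => 1 + -(w * p^(n+1))) := by
    have := multipliable_one_add_of_summable (Ap_summable hp (p*w))
    convert! this using 3 with n
    ring
  have e := tprod_eq_zero_mul' (f := fun n : ℕ => 1 + -(w * p^n)) hm
  simp only [pow_zero, mul_one] at e
  rw [e, ← sub_eq_add_neg]
  congr 1
  exact tprod_congr fun n => by ring

theorem Ap_ne {p : ℂ} (hp : ‖p‖ < 1) (w : ℂ) (h : ∀ j : ℕ, w * p^j ≠ 1) : Ap p w ≠ 0 := by
  apply tprod_one_add_ne_zero_of_summable _ (Ap_summable hp w)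
  intro j hj
  exact h j (by linear_combination -hj)

theorem Ap_diff {p : ℂ} (hp : ‖p‖ < 1) : Differentiable ℂ (Ap p) := by
  have key : HasProdLocallyUniformlyOn (fun (j : ℕ) (w : ℂ) => 1 + -(w * p^j)) (Ap p) Set.univ := by
    apply hasProdLocallyUniformlyOn_of_forall_compact isOpen_univ
    intro K _ hK
    obtain ⟨C, hC⟩ := hK.isBounded.exists_norm_le
    refine ((summable_geometric_of_lt_one (norm_nonneg _) hp).mul_left C).hasProdUniformlyOn_nat_one_add
      hK (.of_forall fun n x hx ↦ ?_) (fun _ ↦ by fun_prop)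
    simp only [norm_neg, norm_mul, norm_pow]
    exact mul_le_mul_of_nonneg_right (hC x hx) (by positivity)
  rw [← differentiableOn_univ]
  exact key.differentiableOn
    (.of_forall fun _ ↦ by simpa [Finset.prod_fn] using
      DifferentiableOn.finsetProd (fun _ _ ↦ by fun_prop)) isOpen_univ

def pp (τ : ℂ) : ℂ := Complex.exp (2*cπ*I*τ)

theorem pp_norm {τ : ℂ} (h : 0 < τ.im) : ‖pp τ‖ < 1 := by
  unfold pp cπ
  exact UpperHalfPlane.norm_exp_two_pi_I_lt_one ⟨τ, h⟩

/-- product form of θ -/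
def Pif (τ x : ℂ) : ℂ :=
  Complex.exp (-cπ*I*x) * (Ap (pp τ) (Complex.exp (2*cπ*I*x)) *
    Ap (pp τ) (pp τ * Complex.exp (-(2*cπ*I*x))))

theorem Pif_diff {τ : ℂ} (h : 0 < τ.im) : Differentiable ℂ (Pif τ) := by
  unfold Pif
  have := Ap_diff (pp_norm h)
  fun_prop

theorem Pif_add_one (τ x : ℂ) : Pif τ (x+1) = - Pif τ x := by
  unfold Pif
  rw [show -cπ*I*(x+1) = -cπ*I*x - cπ*I by ring, show 2*cπ*I*(x+1) = 2*cπ*I*x + 2*cπ*I by ring,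
    neg_add, ← sub_eq_add_neg, Complex.exp_sub, Complex.exp_add, Complex.exp_sub, exp_pi', exp_two_pi]
  simp only [mul_one, div_one]
  ring

theorem Pif_add_tau {τ : ℂ} (h : 0 < τ.im) (x : ℂ) :
    Pif τ (x+τ) = - (Complex.exp (-cπ*I*(τ+2*x)) * Pif τ x) := by
  unfold Pif
  have e1 : Complex.exp (2*cπ*I*(x+τ)) = pp τ * Complex.exp (2*cπ*I*x) := by
    unfold pp; rw [← Complex.exp_add]; congr 1; ring
  have e2 : pp τ * Complex.exp (-(2*cπ*I*(x+τ))) = Complex.exp (-(2*cπ*I*x)) := by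
    unfold pp; rw [← Complex.exp_add]; congr 1; ring
  rw [e1, e2, Ap_succ (pp_norm h) (Complex.exp (-(2*cπ*I*x))),
    Ap_succ (pp_norm h) (Complex.exp (2*cπ*I*x))]
  have e3 : Complex.exp (-cπ*I*(x+τ)) = Complex.exp (-cπ*I*(τ+2*x)) *
    Complex.exp (-cπ*I*x) * Complex.exp (2*cπ*I*x) := by
    rw [← Complex.exp_add, ← Complex.exp_add]; congr 1; ring
  have e4 : Complex.exp (2*cπ*I*x) * Complex.exp (-(2*cπ*I*x)) = 1 := by
    rw [← Complex.exp_add]; simp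
  rw [e3]
  generalize Ap (pp τ) (pp τ * Complex.exp (2*cπ*I*x)) = A
  generalize Ap (pp τ) (pp τ * Complex.exp (-(2*cπ*I*x))) = B
  linear_combination (-Complex.exp (-cπ*I*(τ+2*x)) * Complex.exp (-cπ*I*x) * A * B) * e4

theorem exp_eq_one_lattice (y : ℂ) (h : Complex.exp (2*cπ*I*y) = 1) : ∃ m : ℤ, y = m := by
  obtain ⟨m, hm⟩ := Complex.exp_eq_one_iff.1 h
  refine ⟨m, ?_⟩
  have : (2*cπ*I) ≠ 0 := Complex.two_pi_I_ne_zero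
  apply mul_left_cancel₀ this
  rw [hm]; unfold cπ; ring

theorem Pif_zero {τ : ℂ} (h : 0 < τ.im) (x : ℂ) (hx : Pif τ x = 0) :
    ∃ m n : ℤ, x = m + n * τ := by
  by_contra hcon
  push Not at hcon
  unfold Pif at hx
  refine mul_ne_zero (Complex.exp_ne_zero _) (mul_ne_zero (Ap_ne (pp_norm h) _ ?_)
    (Ap_ne (pp_norm h) _ ?_)) hx
  · intro j hj
    unfold pp at hj
    rw [← Complex.exp_nat_mul, ← Complex.exp_add] at hj
    obtain ⟨m, hm⟩ := exp_eq_one_lattice (x + j*τ) (by rw [← hj]; congr 1; ring)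
    apply hcon m (-j)
    push_cast
    linear_combination hm
  · intro j hj
    unfold pp at hj
    rw [← Complex.exp_nat_mul, ← Complex.exp_add, ← Complex.exp_add] at hj
    obtain ⟨m, hm⟩ := exp_eq_one_lattice ((j+1)*τ - x) (by refine Eq.trans ?_ hj; congr 1; ring)
    apply hcon (-m) (j+1)
    push_cast
    linear_combination -hm

theorem int_shift_ind (τ : ℂ) (Q : ℂ → Prop) (h1 : ∀ z, Q z ↔ Q (z+1)) (h2 : ∀ z, Q z ↔ Q (z+τ))
    (z : ℂ) (hz : Q z) (m n : ℤ) : Q (z + m + n*τ) := by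
  have a : Q (z + m) := by
    induction m using Int.induction_on with
    | zero => simpa using hz
    | succ i hi => 
      have := (h1 _).1 hi
      rw [show z + ((i + 1 : ℤ):ℂ) = z + ((i:ℤ):ℂ) + 1 by push_cast; ring]; exact this
    | pred i hi =>
      rw [h1, show z + ((-i - 1 : ℤ):ℂ) + 1 = z + ((-i:ℤ):ℂ) by push_cast; ring]; exact hi
  induction n using Int.induction_on with
  | zero => simpa using a
  | succ i hi => 
    have := (h2 _).1 hi
    rw [show z + m + ((i + 1 : ℤ):ℂ)*τ = z + m + ((i:ℤ):ℂ)*τ + τ by push_cast; ring]; exact this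
  | pred i hi =>
    rw [h2, show z + m + ((-i - 1 : ℤ):ℂ)*τ + τ = z + m + ((-i:ℤ):ℂ)*τ by push_cast; ring]; exact hi

theorem Pif_simple {τ : ℂ} (h : 0 < τ.im) (m n : ℤ) :
    Pif τ (m + n*τ) = 0 ∧ deriv (Pif τ) (m + n*τ) ≠ 0 := by
  have hd := Pif_diff h
  have := int_shift_ind τ (fun z => Pif τ z = 0 ∧ deriv (Pif τ) z ≠ 0) ?_ ?_ 0 ?_ m n
  · simpa using this
  · intro z
    have e : (fun x => Pif τ (x+1)) = fun x => - Pif τ x := funext (Pif_add_one τ)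
    have e1 : deriv (Pif τ) (z+1) = - deriv (Pif τ) z := by
      have := congrArg (fun F => deriv F z) e
      simpa [deriv_comp_add_const] using this
    simp only [e1, Pif_add_one]
    simp
  · intro z
    have e : (fun x => Pif τ (x+τ)) = fun x => - (Complex.exp (-cπ*I*(τ+2*x)) * Pif τ x) :=
      funext (Pif_add_tau h)
    have e1 : Pif τ z = 0 → deriv (Pif τ) (z+τ) = - (Complex.exp (-cπ*I*(τ+2*z)) * deriv (Pif τ) z) := by
      intro h0
      have := congrArg (fun F => deriv F z) e
      simp only [deriv_comp_add_const] at this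
      rw [this, deriv.fun_neg, deriv_fun_mul (by fun_prop) (hd z), h0]
      simp
    simp only [Pif_add_tau h]
    constructor
    · rintro ⟨h0, h1⟩
      simp [h0, e1 h0, h1]
    · rintro ⟨h0, h1⟩
      have h0' : Pif τ z = 0 := by simpa using h0
      refine ⟨h0', fun h3 => h1 ?_⟩
      rw [e1 h0', h3]; simp
  · have hn : ∀ j : ℕ, pp τ * pp τ ^ j ≠ 1 := by
      intro j hj
      have := congrArg norm hj
      rw [← pow_succ', norm_pow, norm_one] at this
      have h2 := pow_lt_one₀ (norm_nonneg _) (pp_norm h) (Nat.succ_ne_zero j)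
      exact absurd this h2.ne
    have hA := Ap_ne (pp_norm h) (pp τ) hn
    have hAd := Ap_diff (pp_norm h)
    set R : ℂ → ℂ := fun x => Complex.exp (-cπ*I*x) * (Ap (pp τ) (pp τ * Complex.exp (2*cπ*I*x)) *
      Ap (pp τ) (pp τ * Complex.exp (-(2*cπ*I*x)))) with hR
    have hRd : Differentiable ℂ R := by rw [hR]; fun_prop
    have e : Pif τ = fun x => (1 - Complex.exp (2*cπ*I*x)) * R x := by
      funext x
      unfold Pif
      rw [Ap_succ (pp_norm h) (Complex.exp (2*cπ*I*x))]
      simp only [hR]; ring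
    refine ⟨by rw [e]; simp, ?_⟩
    rw [e, deriv_fun_mul (by fun_prop) (hRd 0)]
    have e3 : HasDerivAt (fun x => 1 - Complex.exp (2*cπ*I*x)) (-(1 * (2*cπ*I*1))) 0 := by
      have := (((hasDerivAt_id (0:ℂ)).const_mul (2*cπ*I)).cexp).const_sub 1
      simpa using this
    rw [e3.deriv]
    have : (2*cπ*I) ≠ 0 := Complex.two_pi_I_ne_zero
    simp [hR, hA]
    simpa using this

theorem θ_half_ne {τ : ℂ} (h : 0 < τ.im) : ∃ x, θf τ x ≠ 0 := by
  by_contra hcon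
  push Not at hcon
  have hJ : ∀ x, Jf τ x = 0 := by
    intro x
    have := θ_add_half τ x
    rw [hcon] at this
    exact (mul_eq_zero.1 this.symm).resolve_left (Complex.exp_ne_zero _)
  let F : ℤ → C(ℝ, ℂ) := fun n => ⟨fun x => jacobiTheta₂_term n x τ, by
    unfold jacobiTheta₂_term; fun_prop⟩
  have hs : Summable (fun n => ‖(F n).restrict (⟨Set.uIcc 0 1, isCompact_uIcc⟩ :
      TopologicalSpace.Compacts ℝ)‖) := by
    refine Summable.of_nonneg_of_le (fun _ => norm_nonneg _) (fun n => ?_)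
      ((summable_jacobiTheta₂_term_iff 0 τ).2 h).norm
    refine (ContinuousMap.norm_le _ (norm_nonneg _)).2 fun x => ?_
    simp only [F, ContinuousMap.restrict_apply, ContinuousMap.coe_mk]
    rw [norm_jacobiTheta₂_term, norm_jacobiTheta₂_term]
    simp
  have hsum := intervalIntegral.hasSum_intervalIntegral_of_summable_norm hs
  have e0 : (∫ x in (0:ℝ)..1, ∑' i : ℤ, F i x) = 0 := by
    have : ∀ x : ℝ, ∑' i : ℤ, F i x = 0 := fun x => hJ x
    simp [this]
  rw [e0] at hsum
  have e1 : ∀ n : ℤ, n ≠ 0 → ∫ x in (0:ℝ)..1, F n x = 0 := by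
    intro n hn
    have hc : (2*(Real.pi:ℂ)*I*n) ≠ 0 := mul_ne_zero Complex.two_pi_I_ne_zero (by exact_mod_cast hn)
    simp only [F, ContinuousMap.coe_mk, jacobiTheta₂_term, Complex.exp_add]
    rw [intervalIntegral.integral_mul_const, integral_exp_mul_complex hc]
    have : Complex.exp (2*(Real.pi:ℂ)*I*n) = 1 := by
      rw [mul_comm]; exact Complex.exp_int_mul_two_pi_mul_I n
    simp [this]
  have h2 := hasSum_single (f := fun n : ℤ => ∫ x in (0:ℝ)..1, F n x) 0 e1
  have h3 := h2.unique hsum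
  simp [F, jacobiTheta₂_term] at h3

theorem θ_eq_Pif {τ : ℂ} (h : 0 < τ.im) : ∃ C : ℂ, C ≠ 0 ∧ ∀ x, θf τ x = C * Pif τ x := by
  have hlat : ∀ m n : ℤ, θf τ (m + n*τ) = 0 := by
    intro m n
    have := int_shift_ind τ (fun z => θf τ z = 0) (fun z => by simp [θ_add_one])
      (fun z => by simp [θ_add_tau]) 0 (θ_zero τ) m n
    simpa using this
  obtain ⟨G, hG, hGe⟩ := entire_div (θf τ) (Pif τ) (θ_diff h) (Pif_diff h) (by
    intro z hz
    obtain ⟨m, n, rfl⟩ := Pif_zero h z hz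
    exact ⟨hlat m n, (Pif_simple h m n).2⟩)
  obtain ⟨x₀, hx₀⟩ := θ_half_ne h
  have hP0 : Pif τ x₀ ≠ 0 := fun h0 => hx₀ (by rw [hGe, h0, mul_zero])
  have p1 : ∀ z, G (z+1) = G z := by
    intro z
    have := entire_cancel (fun z => G (z+1) - G z) (Pif τ) (by fun_prop) (Pif_diff h) (by
      intro z
      have := θ_add_one τ z
      rw [hGe, hGe, Pif_add_one] at this
      linear_combination -this) x₀ hP0 z
    exact sub_eq_zero.1 this
  have p2 : ∀ z, G (z+τ) = G z := by
    intro z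
    have := entire_cancel (fun z => G (z+τ) - G z) (Pif τ) (by fun_prop) (Pif_diff h) (by
      intro z
      have := θ_add_tau τ z
      rw [hGe, hGe, Pif_add_tau h] at this
      apply mul_left_cancel₀ (Complex.exp_ne_zero (-cπ*I*(τ+2*z)))
      linear_combination -this) x₀ hP0 z
    exact sub_eq_zero.1 this
  have hc := liouville_elliptic h G hG p1 p2
  refine ⟨G 0, ?_, fun x => by rw [hGe, hc x 0]⟩
  intro h0
  apply hx₀
  rw [hGe, hc x₀ 0, h0, zero_mul]

theorem θ_zero_iff {τ : ℂ} (h : 0 < τ.im) (x : ℂ) : θf τ x = 0 ↔ ∃ m n : ℤ, x = m + n*τ := by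
  obtain ⟨C, hC, e⟩ := θ_eq_Pif h
  constructor
  · intro hx
    rw [e] at hx
    exact Pif_zero h x ((mul_eq_zero.1 hx).resolve_left hC)
  · rintro ⟨m, n, rfl⟩
    rw [e, (Pif_simple h m n).1, mul_zero]

theorem θ_simple {τ : ℂ} (h : 0 < τ.im) (x : ℂ) (hx : θf τ x = 0) : deriv (θf τ) x ≠ 0 := by
  obtain ⟨m, n, rfl⟩ := (θ_zero_iff h x).1 hx
  obtain ⟨C, hC, e⟩ := θ_eq_Pif h
  rw [show θf τ = fun x => C * Pif τ x from funext e, deriv_const_mul_field]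
  exact mul_ne_zero hC (Pif_simple h m n).2

theorem J_zero_iff {τ : ℂ} (h : 0 < τ.im) (x : ℂ) :
    Jf τ x = 0 ↔ ∃ m n : ℤ, x = 1/2 + τ/2 + m + n*τ := by
  have h1 : Jf τ x = 0 ↔ θf τ (x+1/2+τ/2) = 0 := by
    rw [θ_add_half]; simp
  rw [h1, θ_zero_iff h]
  constructor
  · rintro ⟨m, n, e⟩
    exact ⟨m-1, n-1, by push_cast; linear_combination e⟩
  · rintro ⟨m, n, e⟩
    exact ⟨m+1, n+1, by push_cast; linear_combination e⟩

/-! The theta function identity -/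

theorem J_eq_θ (τ x : ℂ) : Jf τ x = Complex.exp (cπ*I*τ/4 + cπ*I*x) * θf τ (x + (1/2+τ/2)) := by
  rw [← add_assoc, θ_add_half, ← mul_assoc, ← Complex.exp_add]
  rw [show cπ*I*τ/4 + cπ*I*x + (-cπ*I*τ/4 - cπ*I*x) = 0 by ring]; simp

theorem J_simple {τ : ℂ} (h : 0 < τ.im) (x : ℂ) (hx : Jf τ x = 0) : deriv (Jf τ) x ≠ 0 := by
  have h0 : θf τ (x + (1/2+τ/2)) = 0 := by
    rw [J_eq_θ] at hx
    exact (mul_eq_zero.1 hx).resolve_left (Complex.exp_ne_zero _)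
  have h1 := θ_simple h _ h0
  have hd := θ_diff h
  rw [show Jf τ = fun x => Complex.exp (cπ*I*τ/4 + cπ*I*x) * θf τ (x + (1/2+τ/2)) from
    funext (J_eq_θ τ), deriv_fun_mul (by fun_prop) (by fun_prop), h0, deriv_comp_add_const]
  simpa using h1

theorem div_lin (H P : ℂ → ℂ) (hH : Differentiable ℂ H) (hs : ∀ x, H x = 0 → deriv H x ≠ 0)
    (hP : Differentiable ℂ P) (k b : ℂ) (hk : k ≠ 0) (h : ∀ z, H (k*z+b) = 0 → P z = 0) :
    ∃ G : ℂ → ℂ, Differentiable ℂ G ∧ ∀ z, P z = G z * H (k*z+b) := by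
  apply entire_div P (fun z => H (k*z+b)) hP (by fun_prop)
  intro z hz
  refine ⟨h z hz, ?_⟩
  have h1 : HasDerivAt (fun z => H (k*z+b)) (deriv H (k*z+b) * (k*1)) z :=
    (hH _).hasDerivAt.comp z (((hasDerivAt_id z).const_mul k).add_const b)
  rw [h1.deriv]
  simpa [hk] using hs _ hz

def qe (b : ℂ) : ℂ := Complex.exp (-2*cπ*I*b)
def Me (τ u : ℂ) : ℂ := Complex.exp (-cπ*I*(τ+2*u))

theorem qe_add (a b : ℂ) : qe (a+b) = qe a * qe b := by
  unfold qe; rw [← Complex.exp_add]; congr 1; ring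
theorem qe_zero : qe 0 = 1 := by simp [qe]
theorem Me_ne (τ u : ℂ) : Me τ u ≠ 0 := Complex.exp_ne_zero _

theorem θ_tau (τ u b : ℂ) : θf τ (u+τ+b) = -(Me τ u * qe b * θf τ (u+b)) := by
  rw [show u+τ+b = (u+b)+τ by ring, θ_add_tau]
  unfold Me qe
  rw [← Complex.exp_add]; congr 3; ring

theorem J_tau (τ u b : ℂ) : Jf τ (u+τ+b) = Me τ u * qe b * Jf τ (u+b) := by
  rw [show u+τ+b = (u+b)+τ by ring, J_add_tau]
  unfold Me qe
  rw [← Complex.exp_add]; congr 2; ring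

theorem θ_two_tau (τ u : ℂ) : θf τ (2*(u+τ)) = Me τ u ^ 4 * θf τ (2*u) := by
  rw [show 2*(u+τ) = (2*u+τ)+τ by ring, θ_add_tau, θ_add_tau]
  have : Complex.exp (-cπ*I*(τ+2*(2*u+τ))) * Complex.exp (-cπ*I*(τ+2*(2*u))) = Me τ u ^ 4 := by
    unfold Me
    rw [← Complex.exp_nat_mul, ← Complex.exp_add]; congr 1; push_cast; ring
  linear_combination θf τ (2*u) * this

theorem θ_two_one (τ u : ℂ) : θf τ (2*(u+1)) = θf τ (2*u) := by
  rw [show 2*(u+1) = (2*u+1)+1 by ring, θ_add_one, θ_add_one, neg_neg]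

def EA (τ a₁ a₂ a₃ a₄ c v u : ℂ) : ℂ :=
  θf τ (2*v) * (θf τ (u+(a₁-c)) * θf τ (u+(a₂-c)) * θf τ (u+(a₃-c)) * θf τ (u+(a₄-c))) *
    Jf τ (u+(-v+2*c)) * Jf τ (u+(v+2*c))

def EB (τ a₁ a₂ a₃ a₄ c v u : ℂ) : ℂ :=
  θf τ (2*u) * (Jf τ (v-a₁-c) * Jf τ (v-a₂-c) * Jf τ (v-a₃-c) * Jf τ (v-a₄-c)) *
    Jf τ (u+(-v-2*c)) * Jf τ (u+(v+2*c))

def EE (τ a₁ a₂ a₃ a₄ c v u : ℂ) : ℂ :=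
  EA τ a₁ a₂ a₃ a₄ c v u + EB τ a₁ a₂ a₃ a₄ c v u
  - EA τ (-a₁) (-a₂) (-a₃) (-a₄) (-c) v u - EB τ (-a₁) (-a₂) (-a₃) (-a₄) (-c) v u

theorem EA_one (τ a₁ a₂ a₃ a₄ c v u : ℂ) :
    EA τ a₁ a₂ a₃ a₄ c v (u+1) = EA τ a₁ a₂ a₃ a₄ c v u := by
  unfold EA
  simp only [add_right_comm u 1, θ_add_one, J_add_one]
  ring

theorem EB_one (τ a₁ a₂ a₃ a₄ c v u : ℂ) :
    EB τ a₁ a₂ a₃ a₄ c v (u+1) = EB τ a₁ a₂ a₃ a₄ c v u := by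
  unfold EB
  rw [θ_two_one]
  simp only [add_right_comm u 1, J_add_one]

theorem EA_tau (τ a₁ a₂ a₃ a₄ c v u : ℂ) (ha : a₁+a₂+a₃+a₄ = 0) :
    EA τ a₁ a₂ a₃ a₄ c v (u+τ) = Me τ u ^ 6 * EA τ a₁ a₂ a₃ a₄ c v u := by
  unfold EA
  simp only [θ_tau, J_tau]
  have : qe (a₁-c) * qe (a₂-c) * qe (a₃-c) * qe (a₄-c) * qe (-v+2*c) * qe (v+2*c) = 1 := by
    simp only [← qe_add]
    rw [← qe_zero]; congr 1; linear_combination ha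
  linear_combination (Me τ u ^ 6 * θf τ (2*v) * (θf τ (u+(a₁-c)) * θf τ (u+(a₂-c)) * θf τ (u+(a₃-c)) * θf τ (u+(a₄-c))) *
    Jf τ (u+(-v+2*c)) * Jf τ (u+(v+2*c))) * this

theorem EB_tau (τ a₁ a₂ a₃ a₄ c v u : ℂ) :
    EB τ a₁ a₂ a₃ a₄ c v (u+τ) = Me τ u ^ 6 * EB τ a₁ a₂ a₃ a₄ c v u := by
  unfold EB
  rw [θ_two_tau]
  simp only [J_tau]
  have : qe (-v-2*c) * qe (v+2*c) = 1 := by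
    simp only [← qe_add]
    rw [← qe_zero]; congr 1; ring
  linear_combination (Me τ u ^ 6 * θf τ (2*u) * (Jf τ (v-a₁-c) * Jf τ (v-a₂-c) * Jf τ (v-a₃-c) * Jf τ (v-a₄-c)) *
    Jf τ (u+(-v-2*c)) * Jf τ (u+(v+2*c))) * this

theorem EE_one (τ a₁ a₂ a₃ a₄ c v u : ℂ) :
    EE τ a₁ a₂ a₃ a₄ c v (u+1) = EE τ a₁ a₂ a₃ a₄ c v u := by
  unfold EE; simp only [EA_one, EB_one]

theorem EE_tau (τ a₁ a₂ a₃ a₄ c v u : ℂ) (ha : a₁+a₂+a₃+a₄ = 0) :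
    EE τ a₁ a₂ a₃ a₄ c v (u+τ) = Me τ u ^ 6 * EE τ a₁ a₂ a₃ a₄ c v u := by
  unfold EE
  rw [EA_tau _ _ _ _ _ _ _ _ ha, EB_tau, EB_tau, EA_tau _ _ _ _ _ _ _ _ (by linear_combination -ha)]
  ring

theorem J_flip (τ x y : ℂ) (h : x = -y) : Jf τ x = Jf τ y := by rw [h, J_neg]
theorem θ_flip (τ x y : ℂ) (h : x = -y) : θf τ x = -θf τ y := by rw [h, θ_neg]

theorem EA_neg (τ a₁ a₂ a₃ a₄ c v u : ℂ) :
    EA τ a₁ a₂ a₃ a₄ c v (-u) = EA τ (-a₁) (-a₂) (-a₃) (-a₄) (-c) v u := by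
  unfold EA
  rw [θ_flip τ (-u+(a₁-c)) (u+(-a₁- -c)) (by ring), θ_flip τ (-u+(a₂-c)) (u+(-a₂- -c)) (by ring),
    θ_flip τ (-u+(a₃-c)) (u+(-a₃- -c)) (by ring), θ_flip τ (-u+(a₄-c)) (u+(-a₄- -c)) (by ring),
    J_flip τ (-u+(-v+2*c)) (u+(v+2* -c)) (by ring), J_flip τ (-u+(v+2*c)) (u+(-v+2* -c)) (by ring)]
  ring

theorem EB_neg (τ a₁ a₂ a₃ a₄ c v u : ℂ) :
    EB τ a₁ a₂ a₃ a₄ c v (-u) = - EB τ a₁ a₂ a₃ a₄ c v u := by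
  unfold EB
  rw [θ_flip τ (2*-u) (2*u) (by ring),
    J_flip τ (-u+(-v-2*c)) (u+(v+2* c)) (by ring), J_flip τ (-u+(v+2*c)) (u+(-v-2*c)) (by ring)]
  ring

theorem EE_neg (τ a₁ a₂ a₃ a₄ c v u : ℂ) :
    EE τ a₁ a₂ a₃ a₄ c v (-u) = - EE τ a₁ a₂ a₃ a₄ c v u := by
  unfold EE; simp only [EA_neg, EB_neg, neg_neg]; ring

theorem EE_swap (τ a₁ a₂ a₃ a₄ c v u : ℂ) :
    EE τ (-a₁) (-a₂) (-a₃) (-a₄) (-c) v u = - EE τ a₁ a₂ a₃ a₄ c v u := by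
  unfold EE; simp only [neg_neg]; ring

theorem EE_shift (τ a₁ a₂ a₃ a₄ c v u : ℂ) (ha : a₁+a₂+a₃+a₄ = 0)
    (h : EE τ a₁ a₂ a₃ a₄ c v u = 0) (m n : ℤ) : EE τ a₁ a₂ a₃ a₄ c v (u + m + n*τ) = 0 :=
  int_shift_ind τ (fun u => EE τ a₁ a₂ a₃ a₄ c v u = 0) (fun z => by simp only [EE_one])
    (fun z => by simp only [EE_tau _ _ _ _ _ _ _ _ ha]; simp [Me_ne]) u h m n

theorem EE_halfper {τ : ℂ} (hτ : 0 < τ.im) (a₁ a₂ a₃ a₄ c v u : ℂ) (ha : a₁+a₂+a₃+a₄ = 0)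
    (h : θf τ (2*u) = 0) : EE τ a₁ a₂ a₃ a₄ c v u = 0 := by
  obtain ⟨m, n, e⟩ := (θ_zero_iff hτ _).1 h
  have z0 : EE τ a₁ a₂ a₃ a₄ c v 0 = 0 := by
    have := EE_neg τ a₁ a₂ a₃ a₄ c v 0
    rw [neg_zero] at this; linear_combination this/2
  have z1 : EE τ a₁ a₂ a₃ a₄ c v (1/2) = 0 := by
    have := EE_neg τ a₁ a₂ a₃ a₄ c v (1/2)
    rw [← EE_one, show -(1/2)+1 = (1/2:ℂ) by ring] at this; linear_combination this/2
  have z2 : EE τ a₁ a₂ a₃ a₄ c v (τ/2) = 0 := by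
    have h1 := EE_neg τ a₁ a₂ a₃ a₄ c v (τ/2)
    have h2 := EE_tau τ a₁ a₂ a₃ a₄ c v (-(τ/2)) ha
    rw [show -(τ/2)+τ = τ/2 by ring] at h2
    have : Me τ (-(τ/2)) = 1 := by
      unfold Me; rw [show -cπ*I*(τ+2*(-(τ/2))) = 0 by ring]; simp
    rw [this] at h2; linear_combination h1/2 + h2/2
  have z3 : EE τ a₁ a₂ a₃ a₄ c v (1/2+τ/2) = 0 := by
    have h1 := EE_neg τ a₁ a₂ a₃ a₄ c v (1/2+τ/2)
    have h2 := EE_tau τ a₁ a₂ a₃ a₄ c v (-(1/2+τ/2)) ha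
    rw [← EE_one, show -(1/2+τ/2)+τ+1 = 1/2+τ/2 by ring] at h2
    have : Me τ (-(1/2+τ/2)) = -1 := by
      unfold Me; rw [show -cπ*I*(τ+2*(-(1/2+τ/2))) = cπ*I by ring, exp_pi']
    rw [this] at h2; linear_combination h1/2 + h2/2
  have S := fun u h => EE_shift τ a₁ a₂ a₃ a₄ c v u ha h
  rcases Int.even_or_odd' m with ⟨m', rfl | rfl⟩ <;> rcases Int.even_or_odd' n with ⟨n', rfl | rfl⟩ <;>
    push_cast at e
  · rw [show u = 0 + m' + n'*τ by linear_combination e/2]; exact S _ z0 _ _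
  · rw [show u = τ/2 + m' + n'*τ by linear_combination e/2]; exact S _ z2 _ _
  · rw [show u = 1/2 + m' + n'*τ by linear_combination e/2]; exact S _ z1 _ _
  · rw [show u = 1/2+τ/2 + m' + n'*τ by linear_combination e/2]; exact S _ z3 _ _

theorem J_half_zero (τ : ℂ) : Jf τ (1/2+τ/2) = 0 := by
  have := J_add_half τ 0
  rw [θ_zero, zero_add] at this; rw [this]; simp

theorem EE_z1_rep (τ a₁ a₂ a₃ a₄ c v : ℂ) (ha : a₁+a₂+a₃+a₄ = 0) :
    EE τ a₁ a₂ a₃ a₄ c v (v-2*c+1/2+τ/2) = 0 := by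
  unfold EE EA EB
  have e1 : Jf τ (v-2*c+1/2+τ/2+(-v+2*c)) = 0 := by
    rw [← J_half_zero τ]; congr 1; ring
  have e1' : Jf τ (v-2*c+1/2+τ/2+(-v-2*-c)) = 0 := by
    rw [← J_half_zero τ]; congr 1; ring
  rw [e1, e1']
  have e2 : θf τ (2*(v-2*c+1/2+τ/2)) = Complex.exp (-cπ*I*(τ+2*(2*v-4*c))) * θf τ (2*v-4*c) := by
    rw [show 2*(v-2*c+1/2+τ/2) = (2*v-4*c)+τ+1 by ring, θ_add_one, θ_add_tau, neg_neg]
  have e3 : Jf τ (v-2*c+1/2+τ/2+(v+2*c)) = I * (Complex.exp (-cπ*I*τ/4 - cπ*I*(2*v)) * θf τ (2*v)) := by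
    rw [← J_add_half]; congr 1; ring
  have e4 : Jf τ (v-2*c+1/2+τ/2+(v+2*-c)) =
      I * (Complex.exp (-cπ*I*τ/4 - cπ*I*(2*v-4*c)) * θf τ (2*v-4*c)) := by
    rw [← J_add_half]; congr 1; ring
  have e5 : v-2*c+1/2+τ/2+(-v-2*c) = v-2*c+1/2+τ/2+(-v+2*-c) := by ring
  have e6 : ∀ a, θf τ (v-2*c+1/2+τ/2+(-a - -c)) =
      Complex.exp (-cπ*I*τ/4 - cπ*I*(v-a-c)) * Jf τ (v-a-c) := by
    intro a; rw [← θ_add_half]; congr 1; ring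
  rw [e2, e3, e4, e5, e6, e6, e6, e6]
  have key : Complex.exp (-cπ*I*(τ+2*(2*v-4*c))) * Complex.exp (-cπ*I*τ/4 - cπ*I*(2*v)) =
     Complex.exp (-cπ*I*τ/4 - cπ*I*(2*v-4*c)) * (Complex.exp (-cπ*I*τ/4 - cπ*I*(v-a₁-c)) *
      Complex.exp (-cπ*I*τ/4 - cπ*I*(v-a₂-c)) * Complex.exp (-cπ*I*τ/4 - cπ*I*(v-a₃-c)) *
      Complex.exp (-cπ*I*τ/4 - cπ*I*(v-a₄-c))) := by
    simp only [← Complex.exp_add]; congr 1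
    linear_combination (-cπ*I) * ha
  linear_combination (I * θf τ (2*v-4*c) * θf τ (2*v) *
    (Jf τ (v-a₁-c) * Jf τ (v-a₂-c) * Jf τ (v-a₃-c) * Jf τ (v-a₄-c)) *
    Jf τ (v-2*c+1/2+τ/2+(-v+2*-c))) * key

theorem EE_z1 {τ : ℂ} (hτ : 0 < τ.im) (a₁ a₂ a₃ a₄ c v u : ℂ) (ha : a₁+a₂+a₃+a₄ = 0)
    (h : Jf τ (u - v + 2*c) = 0) : EE τ a₁ a₂ a₃ a₄ c v u = 0 := by
  obtain ⟨m, n, e⟩ := (J_zero_iff hτ _).1 h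
  rw [show u = (v-2*c+1/2+τ/2) + m + n*τ by linear_combination e]
  exact EE_shift _ _ _ _ _ _ _ _ ha (EE_z1_rep _ _ _ _ _ _ _ ha) m n

theorem EE_z2 {τ : ℂ} (hτ : 0 < τ.im) (a₁ a₂ a₃ a₄ c v u : ℂ) (ha : a₁+a₂+a₃+a₄ = 0)
    (h : Jf τ (u + v - 2*c) = 0) : EE τ a₁ a₂ a₃ a₄ c v u = 0 := by
  have := EE_z1 hτ a₁ a₂ a₃ a₄ c v (-u) ha (by rw [← h]; apply J_flip; ring)
  rw [EE_neg] at this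
  exact neg_eq_zero.1 this

theorem EE_generic {τ : ℂ} (hτ : 0 < τ.im) (a₁ a₂ a₃ a₄ c v : ℂ) (ha : a₁+a₂+a₃+a₄ = 0)
    (g1 : θf τ (2*v-4*c) ≠ 0) (g2 : θf τ (2*v+4*c) ≠ 0) (g3 : θf τ (4*c) ≠ 0)
    (g4 : θf τ (2*v) ≠ 0) (u : ℂ) : EE τ a₁ a₂ a₃ a₄ c v u = 0 := by
  have dθ := θ_diff hτ
  have dJ := J_diff hτ
  have dE : Differentiable ℂ (EE τ a₁ a₂ a₃ a₄ c v) := by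
    unfold EE EA EB; fun_prop
  obtain ⟨G1, dG1, h1⟩ := div_lin (θf τ) _ dθ (θ_simple hτ) dE 2 0 two_ne_zero (fun z hz =>
    EE_halfper hτ _ _ _ _ _ _ _ ha (by simpa using hz))
  have n1 : ∀ u, Jf τ (u - v + 2*c) = 0 → θf τ (2*u+0) ≠ 0 := by
    intro u hu h0
    obtain ⟨m, n, e⟩ := (J_zero_iff hτ _).1 hu
    obtain ⟨m', n', e'⟩ := (θ_zero_iff hτ _).1 h0
    apply g1
    rw [θ_zero_iff hτ]
    exact ⟨m' - 2*m - 1, n' - 2*n - 1, by push_cast; linear_combination e' - 2*e⟩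
  obtain ⟨G2, dG2, h2⟩ := div_lin (Jf τ) G1 dJ (J_simple hτ) dG1 1 (-v+2*c) one_ne_zero (fun z hz => by
    have hz' : Jf τ (z - v + 2*c) = 0 := by rw [← hz]; congr 1; ring
    have := EE_z1 hτ a₁ a₂ a₃ a₄ c v z ha hz'
    rw [h1] at this
    exact (mul_eq_zero.1 this).resolve_right (n1 z hz'))
  obtain ⟨G3, dG3, h3⟩ := div_lin (Jf τ) G2 dJ (J_simple hτ) dG2 1 (v-2*c) one_ne_zero (fun z hz => by
    have hz' : Jf τ (z + v - 2*c) = 0 := by rw [← hz]; congr 1; ring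
    have := EE_z2 hτ a₁ a₂ a₃ a₄ c v z ha hz'
    rw [h1, h2] at this
    have m1 : θf τ (2*z+0) ≠ 0 := by
      have := n1 (-z) (by rw [← hz']; apply J_flip; ring)
      rwa [θ_flip τ (2 * -z + 0) (2*z+0) (by ring), neg_ne_zero] at this
    have m2 : Jf τ (1*z+(-v+2*c)) ≠ 0 := by
      intro h0
      obtain ⟨m, n, e⟩ := (J_zero_iff hτ _).1 hz
      obtain ⟨m', n', e'⟩ := (J_zero_iff hτ _).1 h0
      apply g1
      rw [θ_zero_iff hτ]
      exact ⟨m-m', n-n', by push_cast; linear_combination e-e'⟩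
    exact (mul_eq_zero.1 ((mul_eq_zero.1 this).resolve_right m1)).resolve_right m2)
  set D : ℂ → ℂ := fun z => Jf τ (z+(v-2*c)) * Jf τ (z+(-v+2*c)) * θf τ (2*z) with hD
  have dD : Differentiable ℂ D := by rw [hD]; fun_prop
  have hE : ∀ z, EE τ a₁ a₂ a₃ a₄ c v z = G3 z * D z := by
    intro z; rw [h1, h2, h3]; simp only [hD, one_mul, add_zero]; ring
  have D1 : ∀ z, D (z+1) = D z := by
    intro z; simp only [hD, θ_two_one, add_right_comm z 1, J_add_one]
  have Dt : ∀ z, D (z+τ) = Me τ z ^ 6 * D z := by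
    intro z; simp only [hD, θ_two_tau, J_tau]
    have : qe (v-2*c) * qe (-v+2*c) = 1 := by
      rw [← qe_add, ← qe_zero]; congr 1; ring
    linear_combination (Me τ z ^ 6 * Jf τ (z+(v-2*c)) * Jf τ (z+(-v+2*c)) * θf τ (2*z)) * this
  set u₀ := v + 2*c + 1/2 + τ/2 with hu₀
  have hD0 : D u₀ ≠ 0 := by
    simp only [hD, hu₀]
    rw [show v+2*c+1/2+τ/2+(v-2*c) = 2*v+1/2+τ/2 by ring, show v+2*c+1/2+τ/2+(-v+2*c) = 4*c+1/2+τ/2 by ring,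
      show 2*(v+2*c+1/2+τ/2) = (2*v+4*c)+τ+1 by ring, θ_add_one, θ_add_tau, J_add_half, J_add_half]
    simp [g2, g3, g4]
  have p1 : ∀ z, G3 (z+1) = G3 z := by
    intro z
    have := entire_cancel (fun z => G3 (z+1) - G3 z) D (by fun_prop) dD (by
      intro z
      have := EE_one τ a₁ a₂ a₃ a₄ c v z
      rw [hE, hE, D1] at this
      linear_combination this) u₀ hD0 z
    exact sub_eq_zero.1 this
  have p2 : ∀ z, G3 (z+τ) = G3 z := by
    intro z
    have := entire_cancel (fun z => G3 (z+τ) - G3 z) D (by fun_prop) dD (by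
      intro z
      have := EE_tau τ a₁ a₂ a₃ a₄ c v z ha
      rw [hE, hE, Dt] at this
      apply mul_left_cancel₀ (pow_ne_zero 6 (Me_ne τ z))
      linear_combination this) u₀ hD0 z
    exact sub_eq_zero.1 this
  have hc := liouville_elliptic hτ G3 dG3 p1 p2 u u₀
  have h0 : EE τ a₁ a₂ a₃ a₄ c v u₀ = 0 := by
    have := EE_z1_rep τ (-a₁) (-a₂) (-a₃) (-a₄) (-c) v (by linear_combination -ha)
    rw [EE_swap, show v - 2 * -c + 1/2+τ/2 = u₀ by rw [hu₀]; ring] at this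
    exact neg_eq_zero.1 this
  rw [hE] at h0 ⊢
  rw [hc, (mul_eq_zero.1 h0).resolve_right hD0, zero_mul]

theorem EE_zero {τ : ℂ} (hτ : 0 < τ.im) (a₁ a₂ a₃ a₄ c v u : ℂ) (ha : a₁+a₂+a₃+a₄ = 0) :
    EE τ a₁ a₂ a₃ a₄ c v u = 0 := by
  have dθ := θ_diff hτ
  have dJ := J_diff hτ
  obtain ⟨x₀, hx₀⟩ := θ_half_ne hτ
  refine entire_cancel (fun v => EE τ a₁ a₂ a₃ a₄ c v u) (fun v => θf τ (2*v))
    (by unfold EE EA EB; fun_prop) (by fun_prop) (fun v => ?_) (x₀/2)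
    (by rwa [mul_div_cancel₀ _ two_ne_zero]) v
  by_cases g4 : θf τ (2*v) = 0
  · simp [g4]
  rw [mul_eq_zero]; left
  refine entire_cancel (fun c => EE τ a₁ a₂ a₃ a₄ c v u) (fun c => θf τ (4*c))
    (by unfold EE EA EB; fun_prop) (by fun_prop) ?_ (x₀/4) (by
      rwa [mul_div_cancel₀ _ (by norm_num : (4:ℂ) ≠ 0)]) c
  refine entire_cancel (fun c => EE τ a₁ a₂ a₃ a₄ c v u * θf τ (4*c)) (fun c => θf τ (2*v+4*c))
    (by unfold EE EA EB; fun_prop) (by fun_prop) ?_ ((x₀-2*v)/4) (by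
      rwa [mul_div_cancel₀ _ (by norm_num : (4:ℂ) ≠ 0), add_sub_cancel])
  refine entire_cancel (fun c => EE τ a₁ a₂ a₃ a₄ c v u * θf τ (4*c) * θf τ (2*v+4*c))
    (fun c => θf τ (2*v-4*c))
    (by unfold EE EA EB; fun_prop) (by fun_prop) ?_ ((2*v-x₀)/4) (by
      rwa [mul_div_cancel₀ _ (by norm_num : (4:ℂ) ≠ 0), sub_sub_cancel])
  intro c
  by_cases g1 : θf τ (2*v-4*c) = 0
  · simp [g1]
  by_cases g2 : θf τ (2*v+4*c) = 0
  · simp [g2]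
  by_cases g3 : θf τ (4*c) = 0
  · simp [g3]
  simp [EE_generic hτ a₁ a₂ a₃ a₄ c v ha g1 g2 g3 g4 u]


def BB (τ a₁ a₂ a₃ a₄ c v u : ℂ) : ℂ :=
  θf τ (2*v) * (θf τ (u+(a₁-c)) * θf τ (u+(a₂-c)) * θf τ (u+(a₃-c)) * θf τ (u+(a₄-c))) *
    Jf τ (u+(-v+2*c)) +
  θf τ (2*u) * (Jf τ (v-a₁-c) * Jf τ (v-a₂-c) * Jf τ (v-a₃-c) * Jf τ (v-a₄-c)) *
    Jf τ (u+(-v-2*c))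

theorem BB_swap {τ : ℂ} (hτ : 0 < τ.im) (a₁ a₂ a₃ a₄ c v u : ℂ) (ha : a₁+a₂+a₃+a₄ = 0) :
    BB τ a₁ a₂ a₃ a₄ c v u * Jf τ (u+v+2*c) =
    BB τ (-a₁) (-a₂) (-a₃) (-a₄) (-c) v u * Jf τ (u+v-2*c) := by
  have := EE_zero hτ a₁ a₂ a₃ a₄ c v u ha
  unfold EE EA EB at this
  unfold BB
  rw [show u+v+2*c = u+(v+2*c) by ring, show u+v-2*c = u+(v+2*(-c)) by ring]
  linear_combination this

theorem BB_zero {τ : ℂ} (hτ : 0 < τ.im) (a₁ a₂ a₃ a₄ c v u : ℂ) (ha : a₁+a₂+a₃+a₄ = 0)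
    (h : Jf τ (u+v-2*c) = 0) : BB τ a₁ a₂ a₃ a₄ c v u = 0 := by
  have dθ := θ_diff hτ
  have dJ := J_diff hτ
  obtain ⟨x₀, hx₀⟩ : ∃ x, Jf τ x ≠ 0 := by
    obtain ⟨x, hx⟩ := θ_half_ne hτ
    refine ⟨x+1/2+τ/2, ?_⟩
    rw [J_add_half]
    exact mul_ne_zero I_ne_zero (mul_ne_zero (Complex.exp_ne_zero _) hx)
  obtain ⟨w, hw⟩ : ∃ w, w = u+v-2*c := ⟨_, rfl⟩
  have hu : u = w - v + 2*c := by rw [hw]; ring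
  rw [hu]
  refine entire_cancel (fun c => BB τ a₁ a₂ a₃ a₄ c v (w-v+2*c)) (fun c => Jf τ (w+4*c))
    (by unfold BB; fun_prop) (by fun_prop) ?_ ((x₀-w)/4) ?_ c
  · intro c
    have := BB_swap hτ a₁ a₂ a₃ a₄ c v (w-v+2*c) ha
    rw [show w-v+2*c+v-2*c = w by ring, hw, h, mul_zero, ← hw] at this
    rw [← this]; congr 2; ring
  · rwa [mul_div_cancel₀ _ (by norm_num : (4:ℂ) ≠ 0), add_sub_cancel]

theorem J_conj (t : ℝ) (x : ℂ) :
    (starRingEnd ℂ) (Jf (t*I) x) = Jf (t*I) ((starRingEnd ℂ) x) := by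
  unfold Jf
  rw [jacobiTheta₂_conj]
  simp

theorem θ_conj (t : ℝ) (x : ℂ) :
    (starRingEnd ℂ) (θf (t*I) x) = θf (t*I) ((starRingEnd ℂ) x) := by
  obtain ⟨w, rfl⟩ : ∃ w, x = w + 1/2 + (t*I)/2 := ⟨x - 1/2 - (t*I)/2, by ring⟩
  rw [θ_add_half, map_mul, J_conj, ← Complex.exp_conj]
  have e : (starRingEnd ℂ) (w + 1/2 + (t*I)/2) = ((starRingEnd ℂ) w - t*I) + 1/2 + (t*I)/2 := by
    simp only [map_add, map_div₀, map_mul, map_one, map_ofNat, conj_I, conj_ofReal]; ring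
  have h := J_add_tau (t*I) ((starRingEnd ℂ) w - t*I)
  rw [sub_add_cancel] at h
  rw [e, θ_add_half, h, ← mul_assoc, ← Complex.exp_add]
  congr 2
  simp only [cπ, map_sub, map_mul, map_neg, map_div₀, conj_I, conj_ofReal, map_ofNat]
  ring

theorem shift_int (K : ℂ → ℂ) (hper : ∀ z, K (z+1) = K z) (r : ℝ)
    (hd : ∀ z : ℂ, |z.im| ≤ |r| → DifferentiableAt ℂ K z) :
    ∫ x in (0:ℝ)..1, K (x + r*I) = ∫ x in (0:ℝ)..1, K (x - r*I) := by
  have h := Complex.integral_boundary_rect_eq_zero_of_differentiableOn K (((-r:ℝ):ℂ)*I) (1+(r:ℂ)*I) (by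
    intro z hz
    apply DifferentiableAt.differentiableWithinAt
    apply hd
    have := hz.2
    simp only [Set.mem_preimage] at this
    have h2 := Set.mem_uIcc.1 this
    simp at h2
    rw [abs_le]
    rcases h2 with h2 | h2
    · constructor <;> linarith [le_abs_self r]
    · constructor <;> linarith [neg_abs_le r, neg_le_abs r])
  simp at h
  have e : ∀ y : ℝ, K (1 + y*I) = K (y*I) := fun y => by rw [add_comm, hper]
  simp only [e] at h
  rw [add_sub_cancel_right, sub_eq_zero] at h
  rw [← h]
  simp only [sub_eq_add_neg]

theorem J_ne_im (t : ℝ) (ht : 0 < t) (w : ℂ) (h : |w.im| < t/2) : Jf (t*I) w ≠ 0 := by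
  intro hw
  obtain ⟨m, n, e⟩ := (J_zero_iff (by simpa using ht) w).1 hw
  have e2 := congrArg Complex.im e
  simp at e2
  rw [abs_lt] at h
  have h1 : (n:ℝ) < 0 := by nlinarith
  have h2 : (-1:ℝ) < n := by nlinarith
  have h1' : n < 0 := by exact_mod_cast h1
  have h2' : -1 < n := by exact_mod_cast h2
  omega

theorem J_ne_re (t : ℝ) (ht : 0 < t) (w : ℂ) (h : w.re = 0) : Jf (t*I) w ≠ 0 := by
  intro hw
  obtain ⟨m, n, e⟩ := (J_zero_iff (by simpa using ht) w).1 hw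
  have e2 := congrArg Complex.re e
  simp [h] at e2
  have : (2*m+1:ℝ) = 0 := by linarith
  have : 2*m+1 = 0 := by exact_mod_cast this
  omega

def den (τ η : ℂ) (N : ℕ) (X : ℂ) : ℂ :=
  ∏ k ∈ Finset.range (N+2), Jf τ (2*X + (2*(k:ℂ) - N - 1)*η)

def den0 (τ η : ℂ) (N : ℕ) (X : ℂ) : ℂ :=
  ∏ k ∈ Finset.range (N+1), Jf τ (2*X + (2*(k:ℂ) - N)*η)

theorem den_neg (τ η : ℂ) (N : ℕ) (X : ℂ) : den τ (-η) N X = den τ η N X := by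
  unfold den
  rw [← Finset.prod_range_reflect]
  apply Finset.prod_congr rfl
  intro k hk
  have : k ≤ N+1 := by have := Finset.mem_range.1 hk; omega
  congr 1
  rw [show N+2-1-k = N+1-k by omega, Nat.cast_sub this]
  push_cast; ring

theorem den0_neg (τ η : ℂ) (N : ℕ) (X : ℂ) : den0 τ (-η) N X = den0 τ η N X := by
  unfold den0
  rw [← Finset.prod_range_reflect]
  apply Finset.prod_congr rfl
  intro k hk
  have : k ≤ N := by have := Finset.mem_range.1 hk; omega
  congr 1
  rw [show N+1-1-k = N-k by omega, Nat.cast_sub this]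
  push_cast; ring

theorem den_sub (τ η : ℂ) (N : ℕ) (X : ℂ) :
    den τ η N (X-η/2) = den0 τ η N X * Jf τ (2*X - (N+2)*η) := by
  unfold den den0
  rw [Finset.prod_range_succ']
  congr 1
  · apply Finset.prod_congr rfl
    intro k _
    congr 1
    push_cast; ring
  · congr 1; push_cast; ring

theorem den_add (τ η : ℂ) (N : ℕ) (X : ℂ) :
    den τ η N (X+η/2) = den0 τ η N X * Jf τ (2*X + (N+2)*η) := by
  unfold den den0
  rw [Finset.prod_range_succ]
  congr 1
  · apply Finset.prod_congr rfl
    intro k _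
    congr 1
    push_cast; ring
  · congr 1; push_cast; ring

theorem den_one (τ η : ℂ) (N : ℕ) (X : ℂ) : den τ η N (X+1) = den τ η N X := by
  unfold den
  apply Finset.prod_congr rfl
  intro k _
  rw [show 2*(X+1) + (2*(k:ℂ) - N - 1)*η = (2*X + (2*(k:ℂ) - N - 1)*η) + 1 + 1 by ring,
    J_add_one, J_add_one]

theorem den0_one (τ η : ℂ) (N : ℕ) (X : ℂ) : den0 τ η N (X+1) = den0 τ η N X := by
  unfold den0
  apply Finset.prod_congr rfl
  intro k _
  rw [show 2*(X+1) + (2*(k:ℂ) - N)*η = (2*X + (2*(k:ℂ) - N)*η) + 1 + 1 by ring,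
    J_add_one, J_add_one]

theorem den_tau (τ η : ℂ) (N : ℕ) (X : ℂ) :
    den τ η N (X+τ) = Complex.exp (-4*cπ*I*(N+2)*(τ+2*X)) * den τ η N X := by
  have h : ∀ k : ℕ, Jf τ (2*(X+τ) + (2*(k:ℂ) - N - 1)*η) =
     Complex.exp (-4*cπ*I*(τ+2*X) - 4*cπ*I*(2*k-N-1)*η) * Jf τ (2*X + (2*(k:ℂ) - N - 1)*η) := by
    intro k
    rw [show 2*(X+τ) + (2*(k:ℂ) - N - 1)*η = (2*X + (2*(k:ℂ) - N - 1)*η) + τ + τ by ring,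
      J_add_tau, J_add_tau, ← mul_assoc, ← Complex.exp_add]
    congr 2; ring
  unfold den
  rw [Finset.prod_congr rfl (fun k _ => h k), Finset.prod_mul_distrib, ← Complex.exp_sum]
  congr 2
  rw [Finset.sum_sub_distrib]
  have hs : ∑ k ∈ Finset.range (N+2), (4*cπ*I*(2*(k:ℂ)-N-1)*η) = 0 := by
    rw [← Finset.sum_mul, ← Finset.mul_sum]
    have : ∀ n : ℕ, ∑ k ∈ Finset.range n, (2*(k:ℂ)) = n*(n-1) := by
      intro n
      induction n with
      | zero => simp
      | succ n ih => rw [Finset.sum_range_succ, ih]; push_cast; ring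
    simp only [Finset.sum_sub_distrib, this, Finset.sum_const, Finset.card_range, nsmul_eq_mul]
    push_cast; ring
  rw [hs]
  simp
  ring


def T1 (τ η : ℂ) (N : ℕ) (a₁ a₂ a₃ a₄ : ℂ) (f h : ℂ → ℂ) (X Y : ℂ) : ℂ :=
  θf τ (X+Y+a₁-N*η/2) * θf τ (X+Y+a₂-N*η/2) * θf τ (X+Y+a₃-N*η/2) * θf τ (X+Y+a₄-N*η/2) *
    f (X+Y+η) * h (X-Y) * θf τ (2*(X-Y)) / (den τ η N X * den τ η N Y)

def T4 (τ η : ℂ) (N : ℕ) (a₁ a₂ a₃ a₄ : ℂ) (f h : ℂ → ℂ) (X Y : ℂ) : ℂ :=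
  Jf τ (X-Y-a₁-N*η/2) * Jf τ (X-Y-a₂-N*η/2) * Jf τ (X-Y-a₃-N*η/2) * Jf τ (X-Y-a₄-N*η/2) *
    f (X+Y) * h (X-Y+η) * θf τ (2*(X+Y)) / (den τ η N X * den τ η N Y)

theorem sumT (τ η : ℂ) (N : ℕ) (a₁ a₂ a₃ a₄ : ℂ) (f h : ℂ → ℂ) (X Y : ℂ)
    (h1 : Jf τ (2*Y - (N+2)*η) ≠ 0) (h2 : Jf τ (2*Y + (N+2)*η) ≠ 0) :
    T1 τ η N a₁ a₂ a₃ a₄ f h (X-η/2) (Y-η/2) + T4 τ η N a₁ a₂ a₃ a₄ f h (X-η/2) (Y+η/2) =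
    f (X+Y) * h (X-Y) * BB τ a₁ a₂ a₃ a₄ ((N+2)*η/2) (X-Y) (X+Y) /
      ((den0 τ η N X * Jf τ (2*X - (N+2)*η)) *
       (den0 τ η N Y * Jf τ (2*Y - (N+2)*η) * Jf τ (2*Y + (N+2)*η))) := by
  unfold T1 T4 BB
  rw [den_sub, den_sub, den_add]
  have e1 : ∀ a, X-η/2+(Y-η/2)+a-N*η/2 = X+Y+(a-(N+2)*η/2) := by intro a; ring
  have e2 : X-η/2+(Y-η/2)+η = X+Y := by ring
  have e3 : X-η/2-(Y-η/2) = X-Y := by ring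
  have e4 : ∀ a, X-η/2-(Y+η/2)-a-N*η/2 = X-Y-a-(N+2)*η/2 := by intro a; ring
  have e5 : X-η/2+(Y+η/2) = X+Y := by ring
  have e6 : X-η/2-(Y+η/2)+η = X-Y := by ring
  have e7 : X+Y+(-(X-Y)+2*((N+2)*η/2)) = 2*Y + (N+2)*η := by ring
  have e8 : X+Y+(-(X-Y)-2*((N+2)*η/2)) = 2*Y - (N+2)*η := by ring
  simp only [e1, e2, e3, e4, e5, e6, e7, e8]
  generalize θf τ (2*(X-Y)) = A1
  generalize θf τ (2*(X+Y)) = A2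
  generalize Jf τ (2*Y - (N+2)*η) = p at *
  generalize Jf τ (2*Y + (N+2)*η) = q at *
  generalize Jf τ (2*X - (N+2)*η) = r at *
  generalize den0 τ η N X = d1 at *
  generalize den0 τ η N Y = d2 at *
  generalize θf τ (X+Y+(a₁-(N+2)*η/2)) * θf τ (X+Y+(a₂-(N+2)*η/2)) *
    θf τ (X+Y+(a₃-(N+2)*η/2)) * θf τ (X+Y+(a₄-(N+2)*η/2)) = B1
  generalize Jf τ (X-Y-a₁-(N+2)*η/2) * Jf τ (X-Y-a₂-(N+2)*η/2) *
    Jf τ (X-Y-a₃-(N+2)*η/2) * Jf τ (X-Y-a₄-(N+2)*η/2) = B2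
  generalize f (X+Y) = F
  generalize h (X-Y) = H
  simp only [div_eq_mul_inv, mul_inv]
  have hp : p * p⁻¹ = 1 := mul_inv_cancel₀ h1
  have hq : q * q⁻¹ = 1 := mul_inv_cancel₀ h2
  linear_combination (-(B1*F*H*A1*d1⁻¹*r⁻¹*d2⁻¹*p⁻¹)) * hq + (-(B2*F*H*A2*d1⁻¹*r⁻¹*d2⁻¹*q⁻¹)) * hp

theorem den0_ne (t s : ℝ) (ht : 0 < t) (N : ℕ) (hs : (N+1)*|s| < t/2) (X : ℂ)
    (hX : |X.im| ≤ |s/2|) : den0 (t*I) (s*I) N X ≠ 0 := by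
  unfold den0
  rw [Finset.prod_ne_zero_iff]
  intro k hk
  have hk' : k ≤ N := by have := Finset.mem_range.1 hk; omega
  have hk2 : (k:ℝ) ≤ N := by exact_mod_cast hk'
  have hk0 : (0:ℝ) ≤ k := by positivity
  apply J_ne_im t ht
  refine lt_of_le_of_lt ?_ hs
  have e : (2*X + (2*(k:ℂ) - N)*(s*I)).im = 2*X.im + (2*k-N)*s := by simp
  rw [e]
  rw [abs_div, abs_two] at hX
  calc |2*X.im + (2*k-N)*s| ≤ |2*X.im| + |(2*k-N)*s| := abs_add_le _ _
    _ = 2*|X.im| + |2*(k:ℝ)-N| * |s| := by rw [abs_mul, abs_mul, abs_two]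
    _ ≤ |s| + N*|s| := by
        gcongr
        · linarith
        · rw [abs_le]; constructor <;> linarith
    _ = (N+1)*|s| := by ring

theorem den_ne (t s : ℝ) (ht : 0 < t) (N : ℕ) (hs : (N+1)*|s| < t/2) (x : ℝ) :
    den (t*I) (s*I) N x ≠ 0 := by
  unfold den
  rw [Finset.prod_ne_zero_iff]
  intro k hk
  have hk' : k ≤ N+1 := by have := Finset.mem_range.1 hk; omega
  have hk2 : (k:ℝ) ≤ N+1 := by exact_mod_cast hk'
  have hk0 : (0:ℝ) ≤ k := by positivity
  apply J_ne_im t ht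
  refine lt_of_le_of_lt ?_ hs
  have e : (2*(x:ℂ) + (2*(k:ℂ) - N - 1)*(s*I)).im = (2*k-N-1)*s := by simp
  rw [e, abs_mul]
  gcongr
  rw [abs_le]; constructor <;> linarith

theorem den_ne' (t s : ℝ) (ht : 0 < t) (N : ℕ) (y : ℝ) :
    den (t*I) (s*I) N (y*I) ≠ 0 := by
  unfold den
  rw [Finset.prod_ne_zero_iff]
  intro k hk
  apply J_ne_re t ht
  simp

theorem fixedY (t s : ℝ) (ht : 0 < t) (N : ℕ) (hs : (N+1)*|s| < t/2) (a₁ a₂ a₃ a₄ : ℂ)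
    (ha : a₁+a₂+a₃+a₄ = 0) (f h : ℂ → ℂ) (hf : Differentiable ℂ f) (hh : Differentiable ℂ h)
    (hf1 : ∀ x, f (x+1) = f x) (hh1 : ∀ x, h (x+1) = h x) (Y : ℂ) (hY : Y.re = 0) (τ η : ℂ)
    (hτ : τ = t*I) (hη : η = s*I) :
    ∫ x in (0:ℝ)..1, (T1 τ η N a₁ a₂ a₃ a₄ f h x (Y-η/2) + T4 τ η N a₁ a₂ a₃ a₄ f h x (Y+η/2)) =
    ∫ x in (0:ℝ)..1, (T1 τ (-η) N (-a₁) (-a₂) (-a₃) (-a₄) f h x (Y+η/2) +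
      T4 τ (-η) N (-a₁) (-a₂) (-a₃) (-a₄) f h x (Y-η/2)) := by
  have hτ' : 0 < τ.im := by rw [hτ]; simpa using ht
  have dθ := θ_diff hτ'
  have dJ := J_diff hτ'
  obtain ⟨c, hc⟩ : ∃ c, c = (N+2)*η/2 := ⟨_, rfl⟩
  have J1 : Jf τ (2*Y - (N+2)*η) ≠ 0 := by
    rw [hτ]; apply J_ne_re t ht; simp [hY, hη]
  have J2 : Jf τ (2*Y + (N+2)*η) ≠ 0 := by
    rw [hτ]; apply J_ne_re t ht; simp [hY, hη]
  have J3 : ∀ x : ℝ, Jf τ (2*x - (N+1)*η) ≠ 0 := by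
    intro x
    rw [hτ]; apply J_ne_im t ht
    have : (2*(x:ℂ) - (N+1)*η).im = -((N+1)*s) := by simp [hη]
    rw [this, abs_neg, abs_mul, abs_of_nonneg (by positivity : (0:ℝ) ≤ N+1)]
    exact hs
  have J4 : ∀ x : ℝ, Jf τ (2*x + (N+1)*η) ≠ 0 := by
    intro x
    rw [hτ]; apply J_ne_im t ht
    have : (2*(x:ℂ) + (N+1)*η).im = ((N+1)*s) := by simp [hη]
    rw [this, abs_mul, abs_of_nonneg (by positivity : (0:ℝ) ≤ N+1)]
    exact hs
  obtain ⟨G, dG, hG⟩ := div_lin (Jf τ) (fun X => BB τ a₁ a₂ a₃ a₄ c (X-Y) (X+Y)) dJ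
    (J_simple hτ') (by unfold BB; fun_prop) 2 (-(2*c)) two_ne_zero (by
      intro X hX
      apply BB_zero hτ' _ _ _ _ _ _ _ ha
      rw [← hX]; congr 1; ring)
  have jne : ∀ b : ℂ, Jf τ (2*((0-b)/2)+b) ≠ 0 := by
    intro b
    rw [show 2*((0-b)/2)+b = 0 by ring, hτ]
    apply J_ne_re t ht; simp
  have hG' : ∀ X, BB τ (-a₁) (-a₂) (-a₃) (-a₄) (-c) (X-Y) (X+Y) = G X * Jf τ (2*X+2*c) := by
    intro X
    rw [← sub_eq_zero]
    refine entire_cancel (fun X => BB τ (-a₁) (-a₂) (-a₃) (-a₄) (-c) (X-Y) (X+Y) -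
      G X * Jf τ (2*X+2*c)) (fun X => Jf τ (2*X+-(2*c))) (by unfold BB; fun_prop) (by fun_prop)
      ?_ _ (jne _) X
    intro X
    have h1 := BB_swap hτ' a₁ a₂ a₃ a₄ c (X-Y) (X+Y) ha
    have h2 := hG X
    rw [show X+Y+(X-Y)+2*c = 2*X+2*c by ring, show X+Y+(X-Y)-2*c = 2*X+-(2*c) by ring, h2] at h1
    linear_combination -h1
  have hG1 : ∀ X, G (X+1) = G X := by
    intro X
    rw [← sub_eq_zero]
    refine entire_cancel (fun X => G (X+1) - G X) (fun X => Jf τ (2*X+-(2*c))) (by fun_prop) (by fun_prop)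
      ?_ _ (jne _) X
    intro X
    have h1 := hG X
    have h2 := hG (X+1)
    rw [show 2*(X+1)+-(2*c) = (2*X+-(2*c))+1+1 by ring, J_add_one, J_add_one] at h2
    have h3 : BB τ a₁ a₂ a₃ a₄ c (X+1-Y) (X+1+Y) = BB τ a₁ a₂ a₃ a₄ c (X-Y) (X+Y) := by
      unfold BB
      have e1 : ∀ b, X+1+Y+b = X+Y+b+1 := by intro b; ring
      have e2 : ∀ b, X+1-Y-b-c = X-Y-b-c+1 := by intro b; ring
      rw [show 2*(X+1-Y) = 2*((X-Y)+1) by ring, show 2*(X+1+Y) = 2*((X+Y)+1) by ring, θ_two_one,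
        θ_two_one, show X+1+Y+(-(X+1-Y)+2*c) = X+Y+(-(X-Y)+2*c) by ring,
        show X+1+Y+(-(X+1-Y)-2*c) = X+Y+(-(X-Y)-2*c) by ring]
      simp only [e1, e2, θ_add_one, J_add_one]
      ring
    linear_combination h3 + h1 - h2
  have sh := shift_int (fun X => f (X+Y) * h (X-Y) * G X / (den0 τ η N X *
    (den0 τ η N Y * Jf τ (2*Y - (N+2)*η) * Jf τ (2*Y + (N+2)*η)))) (by
      intro X
      rw [den0_one, hG1, show X+1+Y = X+Y+1 by ring, show X+1-Y = X-Y+1 by ring, hf1, hh1]) (s/2) (by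
      intro X hX
      have := den0_ne t s ht N hs X hX
      rw [← hτ, ← hη] at this
      simp only [div_eq_mul_inv, mul_inv]
      have d0 : Differentiable ℂ (fun X => den0 τ η N X) := by
        unfold den0
        fun_prop
      have d1 : DifferentiableAt ℂ (fun X => (den0 τ η N X)⁻¹) X := (d0 X).inv this
      fun_prop)
  have eη : ((s/2 : ℝ):ℂ)*I = η/2 := by rw [hη]; push_cast; ring
  rw [eη] at sh
  convert sh using 1
  · apply intervalIntegral.integral_congr
    intro x _
    have h1 := sumT τ η N a₁ a₂ a₃ a₄ f h (x+η/2) Y J1 J2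
    have h2 := hG (x+η/2)
    rw [add_sub_cancel_right, ← hc, h2] at h1
    simp only
    rw [h1]
    have e : 2*((x:ℂ)+η/2)+-(2*c) = 2*x-(N+1)*η := by rw [hc]; ring
    have e' : 2*((x:ℂ)+η/2)-(N+2)*η = 2*x-(N+1)*η := by ring
    rw [e, e']
    have := mul_inv_cancel₀ (J3 x)
    simp only [div_eq_mul_inv, mul_inv]
    generalize (Jf τ (2*x-(N+1)*η))⁻¹ = w at *
    generalize (Jf τ (2*x-(N+1)*η)) = w' at *
    linear_combination (f (x+η*2⁻¹+Y) * h (x+η*2⁻¹-Y) * G (x+η*2⁻¹) * (den0 τ η N (x+η*2⁻¹))⁻¹ *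
      ((den0 τ η N Y)⁻¹ * (Jf τ (2*Y - (N+2)*η))⁻¹ * (Jf τ (2*Y + (N+2)*η))⁻¹)) * this
  · apply intervalIntegral.integral_congr
    intro x _
    have h1 := sumT τ (-η) N (-a₁) (-a₂) (-a₃) (-a₄) f h (x-η/2) Y
      (by rwa [show 2*Y-(N+2)*(-η) = 2*Y + (N+2)*η by ring])
      (by rwa [show 2*Y+(N+2)*(-η) = 2*Y - (N+2)*η by ring])
    have h2 := hG' (x-η/2)
    rw [show (x:ℂ)-η/2-(-η)/2 = x by ring, show (N+2)*(-η)/2 = -c by rw [hc]; ring, h2,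
      show Y-(-η)/2 = Y+η/2 by ring, show Y+(-η)/2 = Y-η/2 by ring, den0_neg, den0_neg,
      show 2*Y-(N+2)*(-η) = 2*Y + (N+2)*η by ring, show 2*Y+(N+2)*(-η) = 2*Y - (N+2)*η by ring] at h1
    simp only
    rw [h1]
    have e : 2*((x:ℂ)-η/2)+2*c = 2*x+(N+1)*η := by rw [hc]; ring
    have e' : 2*((x:ℂ)-η/2)-(N+2)*(-η) = 2*x+(N+1)*η := by ring
    rw [e, e']
    have := mul_inv_cancel₀ (J4 x)
    simp only [div_eq_mul_inv, mul_inv]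
    generalize (Jf τ (2*x+(N+1)*η))⁻¹ = w at *
    generalize (Jf τ (2*x+(N+1)*η)) = w' at *
    linear_combination (f (x-η*2⁻¹+Y) * h (x-η*2⁻¹-Y) * G (x-η*2⁻¹) * (den0 τ η N (x-η*2⁻¹))⁻¹ *
      ((den0 τ η N Y)⁻¹ * (Jf τ (2*Y - (N+2)*η))⁻¹ * (Jf τ (2*Y + (N+2)*η))⁻¹)) * this


theorem θ_sub_two_tau (τ w : ℂ) :
    θf τ (w-2*τ) = Complex.exp (4*cπ*I*(w-τ)) * θf τ w := by
  have h1 := θ_add_tau τ (w-2*τ)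
  have h2 := θ_add_tau τ (w-2*τ+τ)
  rw [h1, show w-2*τ+τ+τ = w by ring] at h2
  rw [h2]
  simp only [mul_neg, neg_neg]
  rw [← mul_assoc, ← mul_assoc, ← Complex.exp_add, ← Complex.exp_add]
  rw [show 4*cπ*I*(w-τ) + -cπ*I*(τ+2*(w-2*τ+τ)) + -cπ*I*(τ+2*(w-2*τ)) = 0 by ring,
    Complex.exp_zero, one_mul]

theorem θ_add_two_tau (τ w : ℂ) :
    θf τ (w+2*τ) = Complex.exp (-4*cπ*I*(w+τ)) * θf τ w := by
  rw [show w+2*τ = w+τ+τ by ring, θ_add_tau, θ_add_tau, mul_neg, neg_neg, ← mul_assoc,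
    ← Complex.exp_add]
  congr 2; ring

theorem J_sub_tau (τ w : ℂ) : Jf τ (w-τ) = Complex.exp (cπ*I*(2*w-τ)) * Jf τ w := by
  have h1 := J_add_tau τ (w-τ)
  rw [sub_add_cancel] at h1
  rw [h1, ← mul_assoc, ← Complex.exp_add,
    show cπ*I*(2*w-τ) + -cπ*I*(τ+2*(w-τ)) = 0 by ring, Complex.exp_zero, one_mul]

theorem Th_sub_tau {τ : ℂ} {N : ℕ} {h : ℂ → ℂ} (hh : ThetaSp τ N h) (w : ℂ) :
    h (w-τ) = Complex.exp (2*cπ*I*N*(2*w-τ)) * h w := by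
  have h1 := hh.2.2.1 (w-τ)
  rw [sub_add_cancel] at h1
  rw [h1, ← mul_assoc, ← Complex.exp_add,
    show 2*cπ*I*N*(2*w-τ) + -2*cπ*I*N*(2*(w-τ)+τ) = 0 by ring, Complex.exp_zero, one_mul]

theorem T1_tau {τ : ℂ} (η : ℂ) {N : ℕ} (a₁ a₂ a₃ a₄ : ℂ) (ha : a₁+a₂+a₃+a₄ = 0) {f h : ℂ → ℂ}
    (hf : ThetaSp τ N f) (hh : ThetaSp τ N h) (X Y : ℂ) :
    T1 τ η N a₁ a₂ a₃ a₄ f h X (Y+τ) = T1 τ η N a₁ a₂ a₃ a₄ f h X Y := by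
  unfold T1
  rw [den_tau, mul_left_comm, ← mul_div_mul_left _ (den τ η N X * den τ η N Y)
    (Complex.exp_ne_zero (-4*cπ*I*(N+2)*(τ+2*Y)))]
  congr 1
  have e1 : ∀ a, X+(Y+τ)+a-N*η/2 = (X+Y+a-N*η/2)+τ := by intro a; ring
  rw [e1, e1, e1, e1, θ_add_tau, θ_add_tau, θ_add_tau, θ_add_tau,
    show X+(Y+τ)+η = (X+Y+η)+τ by ring, hf.2.2.1, show X-(Y+τ) = X-Y-τ by ring, Th_sub_tau hh,
    show 2*(X-Y-τ) = 2*(X-Y)-2*τ by ring, θ_sub_two_tau]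
  have key : Complex.exp (-cπ*I*(τ+2*(X+Y+a₁-N*η/2))) * Complex.exp (-cπ*I*(τ+2*(X+Y+a₂-N*η/2))) *
    Complex.exp (-cπ*I*(τ+2*(X+Y+a₃-N*η/2))) * Complex.exp (-cπ*I*(τ+2*(X+Y+a₄-N*η/2))) *
    Complex.exp (-2*cπ*I*N*(2*(X+Y+η)+τ)) * Complex.exp (2*cπ*I*N*(2*(X-Y)-τ)) *
    Complex.exp (4*cπ*I*(2*(X-Y)-τ)) = Complex.exp (-4*cπ*I*(N+2)*(τ+2*Y)) := by
    simp only [← Complex.exp_add]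
    congr 1
    linear_combination (-2*cπ*I)*ha
  linear_combination (θf τ (X+Y+a₁-N*η/2) * θf τ (X+Y+a₂-N*η/2) * θf τ (X+Y+a₃-N*η/2) *
    θf τ (X+Y+a₄-N*η/2) * f (X+Y+η) * h (X-Y) * θf τ (2*(X-Y))) * key

theorem T4_tau {τ : ℂ} (η : ℂ) {N : ℕ} (a₁ a₂ a₃ a₄ : ℂ) (ha : a₁+a₂+a₃+a₄ = 0) {f h : ℂ → ℂ}
    (hf : ThetaSp τ N f) (hh : ThetaSp τ N h) (X Y : ℂ) :
    T4 τ η N a₁ a₂ a₃ a₄ f h X (Y+τ) = T4 τ η N a₁ a₂ a₃ a₄ f h X Y := by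
  unfold T4
  rw [den_tau, mul_left_comm, ← mul_div_mul_left _ (den τ η N X * den τ η N Y)
    (Complex.exp_ne_zero (-4*cπ*I*(N+2)*(τ+2*Y)))]
  congr 1
  have e1 : ∀ a, X-(Y+τ)-a-N*η/2 = (X-Y-a-N*η/2)-τ := by intro a; ring
  rw [e1, e1, e1, e1, J_sub_tau, J_sub_tau, J_sub_tau, J_sub_tau,
    show X-(Y+τ)+η = (X-Y+η)-τ by ring, Th_sub_tau hh, show X+(Y+τ) = X+Y+τ by ring, hf.2.2.1,
    show 2*(X+Y+τ) = 2*(X+Y)+2*τ by ring, θ_add_two_tau]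
  have key : Complex.exp (cπ*I*(2*(X-Y-a₁-N*η/2)-τ)) * Complex.exp (cπ*I*(2*(X-Y-a₂-N*η/2)-τ)) *
    Complex.exp (cπ*I*(2*(X-Y-a₃-N*η/2)-τ)) * Complex.exp (cπ*I*(2*(X-Y-a₄-N*η/2)-τ)) *
    Complex.exp (-2*cπ*I*N*(2*(X+Y)+τ)) * Complex.exp (2*cπ*I*N*(2*(X-Y+η)-τ)) *
    Complex.exp (-4*cπ*I*(2*(X+Y)+τ)) = Complex.exp (-4*cπ*I*(N+2)*(τ+2*Y)) := by
    simp only [← Complex.exp_add]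
    congr 1
    linear_combination (-2*cπ*I)*ha
  linear_combination (Jf τ (X-Y-a₁-N*η/2) * Jf τ (X-Y-a₂-N*η/2) * Jf τ (X-Y-a₃-N*η/2) *
    Jf τ (X-Y-a₄-N*η/2) * f (X+Y) * h (X-Y+η) * θf τ (2*(X+Y))) * key

theorem den_cont {τ : ℂ} (hτ : 0 < τ.im) (η : ℂ) (N : ℕ) : Continuous (den τ η N) := by
  have dJ := (J_diff hτ).continuous
  unfold den
  fun_prop

theorem T1_cont (t s : ℝ) (ht : 0 < t) (N : ℕ) (hs : (N+1)*|s| < t/2) (a₁ a₂ a₃ a₄ : ℂ)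
    (f h : ℂ → ℂ) (hf : Continuous f) (hh : Continuous h) :
    Continuous (fun p : ℝ × ℝ => T1 (t*I) (s*I) N a₁ a₂ a₃ a₄ f h p.2 (p.1*I)) := by
  have hτ' : 0 < ((t:ℂ)*I).im := by simpa using ht
  have dθ := (θ_diff hτ').continuous
  have dd := den_cont hτ' (s*I) N
  unfold T1
  apply Continuous.div
  · fun_prop
  · fun_prop
  · intro p
    exact mul_ne_zero (den_ne t s ht N hs p.2) (den_ne' t s ht N p.1)

theorem T4_cont (t s : ℝ) (ht : 0 < t) (N : ℕ) (hs : (N+1)*|s| < t/2) (a₁ a₂ a₃ a₄ : ℂ)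
    (f h : ℂ → ℂ) (hf : Continuous f) (hh : Continuous h) :
    Continuous (fun p : ℝ × ℝ => T4 (t*I) (s*I) N a₁ a₂ a₃ a₄ f h p.2 (p.1*I)) := by
  have hτ' : 0 < ((t:ℂ)*I).im := by simpa using ht
  have dθ := (θ_diff hτ').continuous
  have dJ := (J_diff hτ').continuous
  have dd := den_cont hτ' (s*I) N
  unfold T4
  apply Continuous.div
  · fun_prop
  · fun_prop
  · intro p
    exact mul_ne_zero (den_ne t s ht N hs p.2) (den_ne' t s ht N p.1)

theorem int_add (t : ℝ) (φ ψ : ℝ → ℝ → ℂ) (hφ : Continuous (fun p : ℝ × ℝ => φ p.1 p.2))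
    (hψ : Continuous (fun p : ℝ × ℝ => ψ p.1 p.2)) :
    ∫ y in (0:ℝ)..t, ∫ x in (0:ℝ)..1, (φ y x + ψ y x) =
    (∫ y in (0:ℝ)..t, ∫ x in (0:ℝ)..1, φ y x) + ∫ y in (0:ℝ)..t, ∫ x in (0:ℝ)..1, ψ y x := by
  rw [← intervalIntegral.integral_add]
  · apply intervalIntegral.integral_congr
    intro y _
    simp only
    rw [← intervalIntegral.integral_add]
    · apply Continuous.intervalIntegrable
      exact hφ.comp (by fun_prop : Continuous fun x : ℝ => (y, x))
    · apply Continuous.intervalIntegrable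
      exact hψ.comp (by fun_prop : Continuous fun x : ℝ => (y, x))
  · apply Continuous.intervalIntegrable
    exact intervalIntegral.continuous_parametric_intervalIntegral_of_continuous' hφ 0 1
  · apply Continuous.intervalIntegrable
    exact intervalIntegral.continuous_parametric_intervalIntegral_of_continuous' hψ 0 1

theorem int_sub (t : ℝ) (φ ψ : ℝ → ℝ → ℂ) (hφ : Continuous (fun p : ℝ × ℝ => φ p.1 p.2))
    (hψ : Continuous (fun p : ℝ × ℝ => ψ p.1 p.2)) :
    ∫ y in (0:ℝ)..t, ∫ x in (0:ℝ)..1, (φ y x - ψ y x) =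
    (∫ y in (0:ℝ)..t, ∫ x in (0:ℝ)..1, φ y x) - ∫ y in (0:ℝ)..t, ∫ x in (0:ℝ)..1, ψ y x := by
  have := int_add t φ (fun y x => - ψ y x) hφ hψ.neg
  simpa [sub_eq_add_neg] using this

theorem int_shift (t r : ℝ) (φ : ℝ → ℝ → ℂ) (hp : ∀ y x, φ (y+t) x = φ y x) :
    ∫ y in (0:ℝ)..t, ∫ x in (0:ℝ)..1, φ (y+r) x = ∫ y in (0:ℝ)..t, ∫ x in (0:ℝ)..1, φ y x := by
  have per : Function.Periodic (fun y => ∫ x in (0:ℝ)..1, φ y x) t := by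
    intro y
    simp only [hp]
  have := per.intervalIntegral_add_eq r 0
  rw [intervalIntegral.integral_comp_add_right (fun y => ∫ x in (0:ℝ)..1, φ y x)]
  rw [zero_add] at this
  rw [zero_add, ← this, add_comm]

theorem dbl_abs (t r : ℝ) (φ1 φ4 ψ1 ψ4 : ℝ → ℝ → ℂ)
    (c1 : Continuous (fun p : ℝ × ℝ => φ1 p.1 p.2)) (c4 : Continuous (fun p : ℝ × ℝ => φ4 p.1 p.2))
    (c1' : Continuous (fun p : ℝ × ℝ => ψ1 p.1 p.2)) (c4' : Continuous (fun p : ℝ × ℝ => ψ4 p.1 p.2))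
    (h1 : ∀ y x, φ1 (y+t) x = φ1 y x) (h4 : ∀ y x, φ4 (y+t) x = φ4 y x)
    (h1' : ∀ y x, ψ1 (y+t) x = ψ1 y x) (h4' : ∀ y x, ψ4 (y+t) x = ψ4 y x)
    (H : ∀ y, ∫ x in (0:ℝ)..1, (φ1 (y + -r) x + φ4 (y+r) x) =
      ∫ x in (0:ℝ)..1, (ψ1 (y + r) x + ψ4 (y + -r) x)) :
    ∫ y in (0:ℝ)..t, ∫ x in (0:ℝ)..1, (φ1 y x - ψ1 y x) =
    ∫ y in (0:ℝ)..t, ∫ x in (0:ℝ)..1, (ψ4 y x - φ4 y x) := by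
  rw [int_sub t φ1 ψ1 c1 c1', int_sub t ψ4 φ4 c4' c4]
  have p1 := int_shift t (-r) φ1 h1
  have p4 := int_shift t r φ4 h4
  have p1' := int_shift t r ψ1 h1'
  have p4' := int_shift t (-r) ψ4 h4'
  have k1 : Continuous (fun p : ℝ × ℝ => (p.1 + -r, p.2)) := by fun_prop
  have k2 : Continuous (fun p : ℝ × ℝ => (p.1 + r, p.2)) := by fun_prop
  have q := int_add t (fun y x => φ1 (y + -r) x) (fun y x => φ4 (y+r) x) (c1.comp k1) (c4.comp k2)
  have q' := int_add t (fun y x => ψ1 (y + r) x) (fun y x => ψ4 (y + -r) x) (c1'.comp k2) (c4'.comp k1)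
  simp only [H] at q
  rw [q'] at q
  rw [p1, p4, p1', p4'] at q
  linear_combination -q

theorem dbl (t s : ℝ) (ht : 0 < t) (N : ℕ) (hs : (N+1)*|s| < t/2) (a₁ a₂ a₃ a₄ : ℂ)
    (ha : a₁+a₂+a₃+a₄ = 0) (f h : ℂ → ℂ) (hf : ThetaSp (t*I) N f) (hh : ThetaSp (t*I) N h) :
    ∫ y in (0:ℝ)..t, ∫ x in (0:ℝ)..1, (T1 (t*I) (s*I) N a₁ a₂ a₃ a₄ f h x (y*I) -
      T1 (t*I) (-(s*I)) N (-a₁) (-a₂) (-a₃) (-a₄) f h x (y*I)) =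
    ∫ y in (0:ℝ)..t, ∫ x in (0:ℝ)..1, (T4 (t*I) (-(s*I)) N (-a₁) (-a₂) (-a₃) (-a₄) f h x (y*I) -
      T4 (t*I) (s*I) N a₁ a₂ a₃ a₄ f h x (y*I)) := by
  have cf := hf.1.continuous
  have ch := hh.1.continuous
  have hs' : (N+1)*|-s| < t/2 := by rwa [abs_neg]
  have en : -((s:ℂ)*I) = ((-s:ℝ):ℂ)*I := by push_cast; ring
  have ha' : -a₁+-a₂+-a₃+-a₄ = 0 := by linear_combination -ha
  have c1 := T1_cont t s ht N hs a₁ a₂ a₃ a₄ f h cf ch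
  have c4 := T4_cont t s ht N hs a₁ a₂ a₃ a₄ f h cf ch
  have c1' := T1_cont t (-s) ht N hs' (-a₁) (-a₂) (-a₃) (-a₄) f h cf ch
  have c4' := T4_cont t (-s) ht N hs' (-a₁) (-a₂) (-a₃) (-a₄) f h cf ch
  rw [← en] at c1' c4'
  have ey : ∀ y : ℝ, ((y+t:ℝ):ℂ)*I = y*I + t*I := by intro y; push_cast; ring
  apply dbl_abs t (s/2) (fun y x => T1 (t*I) (s*I) N a₁ a₂ a₃ a₄ f h x (y*I))
    (fun y x => T4 (t*I) (s*I) N a₁ a₂ a₃ a₄ f h x (y*I))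
    (fun y x => T1 (t*I) (-(s*I)) N (-a₁) (-a₂) (-a₃) (-a₄) f h x (y*I))
    (fun y x => T4 (t*I) (-(s*I)) N (-a₁) (-a₂) (-a₃) (-a₄) f h x (y*I)) c1 c4 c1' c4'
  · intro y x
    rw [ey]; exact T1_tau _ _ _ _ _ ha hf hh _ _
  · intro y x
    rw [ey]; exact T4_tau _ _ _ _ _ ha hf hh _ _
  · intro y x
    rw [ey]; exact T1_tau _ _ _ _ _ ha' hf hh _ _
  · intro y x
    rw [ey]; exact T4_tau _ _ _ _ _ ha' hf hh _ _
  · intro y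
    have := fixedY t s ht N hs a₁ a₂ a₃ a₄ ha f h hf.1 hh.1 hf.2.1 hh.2.1 (y*I) (by simp) _ _ rfl rfl
    have e1 : ((y + -(s/2):ℝ):ℂ)*I = y*I - s*I/2 := by push_cast; ring
    have e2 : ((y + (s/2):ℝ):ℂ)*I = y*I + s*I/2 := by push_cast; ring
    simp only [e1, e2]
    exact this

theorem Mw_eq (τ η : ℂ) (N : ℕ) (X Y : ℂ) :
    Mw τ η N (X+Y) (X-Y) = Complex.exp (cπ*I*τ*(N+2)/2) *
      (θf τ (2*(X+Y)) * θf τ (2*(X-Y)) / (den τ η N X * den τ η N Y)) := by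
  have h : ∀ k : ℕ, θf τ (X+Y+(X-Y) + (2*(k:ℂ) - N - 1)*η + 1/2 + τ/2) *
      θf τ (X+Y-(X-Y) + (2*(k:ℂ) - N - 1)*η + 1/2 + τ/2) =
     Complex.exp ((-cπ*I*τ/2 - 2*cπ*I*(X+Y)) - 2*cπ*I*(2*k-N-1)*η) *
      (Jf τ (2*X + (2*(k:ℂ) - N - 1)*η) * Jf τ (2*Y + (2*(k:ℂ) - N - 1)*η)) := by
    intro k
    rw [θ_add_half, θ_add_half, mul_mul_mul_comm, ← Complex.exp_add]
    congr 1
    · congr 1; ring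
    · congr 2 <;> ring
  unfold Mw
  rw [Finset.prod_congr rfl (fun k _ => h k), Finset.prod_mul_distrib, ← Complex.exp_sum,
    Finset.sum_sub_distrib, Finset.prod_mul_distrib]
  have hs : ∑ k ∈ Finset.range (N+2), (2*cπ*I*(2*(k:ℂ)-N-1)*η) = 0 := by
    rw [← Finset.sum_mul, ← Finset.mul_sum]
    have : ∀ n : ℕ, ∑ k ∈ Finset.range n, (2*(k:ℂ)) = n*(n-1) := by
      intro n
      induction n with
      | zero => simp
      | succ n ih => rw [Finset.sum_range_succ, ih]; push_cast; ring
    simp only [Finset.sum_sub_distrib, this, Finset.sum_const, Finset.card_range, nsmul_eq_mul]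
    push_cast; ring
  rw [hs, Finset.sum_const, Finset.card_range, nsmul_eq_mul, ← mul_assoc, ← Complex.exp_add]
  have e : 2*cπ*I*(X+Y)*(N+2) + (((N+2:ℕ):ℂ)*(-cπ*I*τ/2 - 2*cπ*I*(X+Y)) - 0) =
    -(cπ*I*τ*(N+2)/2) := by push_cast; ring
  rw [e, Complex.exp_neg]
  change _ / (_ * (den τ η N X * den τ η N Y)) = _
  rw [div_mul_eq_div_div, div_inv_eq_mul]
  ring

def gst (g : ℂ → ℂ) (z : ℂ) : ℂ := (starRingEnd ℂ) (g ((starRingEnd ℂ) z))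

theorem gst_theta {t : ℝ} {N : ℕ} {g : ℂ → ℂ} (hg : ThetaSp (t*I) N g) :
    ThetaSp (t*I) N (gst g) := by
  refine ⟨?_, ?_, ?_, ?_⟩
  · intro z
    have := (hg.1 ((starRingEnd ℂ) z)).conj_conj
    rw [Complex.conj_conj] at this
    exact this
  · intro x
    unfold gst
    rw [map_add, map_one, hg.2.1]
  · intro x
    unfold gst
    rw [map_add, show (starRingEnd ℂ) ((t:ℂ)*I) = -(t*I) by simp, ← sub_eq_add_neg, Th_sub_tau hg,
      map_mul, ← Complex.exp_conj]
    congr 2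
    simp [cπ, Complex.conj_ofNat]
  · intro x
    unfold gst
    rw [map_neg, hg.2.2.2]

theorem σD_eq {τ η : ℂ} {N : ℕ} {a₁ a₂ a₃ a₄ : ℂ} (ha : a₁+a₂+a₃+a₄ = 0) {g Dg : ℂ → ℂ}
    (hg : ThetaSp τ N g)
    (hD : ∀ x, θf τ (2*x) * Dg x = ΔRHS τ η N a₁ a₂ a₃ a₄ (σop τ N g) x) (u : ℂ) :
    θf τ (2*u) * σop τ N Dg u =
    Jf τ (u+a₁-N*η/2) * Jf τ (u+a₂-N*η/2) * Jf τ (u+a₃-N*η/2) * Jf τ (u+a₄-N*η/2) * g (u+η) -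
    Jf τ (u-a₁+N*η/2) * Jf τ (u-a₂+N*η/2) * Jf τ (u-a₃+N*η/2) * Jf τ (u-a₄+N*η/2) * g (u-η) := by
  have h := hD (u+1/2+τ/2)
  have e0 : θf τ (2*(u+1/2+τ/2)) = Complex.exp (-cπ*I*(τ+4*u)) * θf τ (2*u) := by
    rw [show 2*(u+1/2+τ/2) = 2*u+τ+1 by ring, θ_add_one, θ_add_tau, neg_neg]
    congr 2; ring
  have e1 : ∀ a, θf τ (u+1/2+τ/2+a-N*η/2) =
      Complex.exp (-cπ*I*τ/4 - cπ*I*(u+a-N*η/2)) * Jf τ (u+a-N*η/2) := by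
    intro a; rw [← θ_add_half]; congr 1; ring
  have e2 : ∀ a, θf τ (u+1/2+τ/2-a+N*η/2) =
      Complex.exp (-cπ*I*τ/4 - cπ*I*(u-a+N*η/2)) * Jf τ (u-a+N*η/2) := by
    intro a; rw [← θ_add_half]; congr 1; ring
  have e3 : ∀ w, σop τ N g (w+1/2+τ/2) =
      Complex.exp (2*cπ*I*N*(1/4+τ/4+(w+1/2+τ/2)) - 2*cπ*I*N*(2*w+τ)) * g w := by
    intro w
    unfold σop
    rw [show w+1/2+τ/2+1/2+τ/2 = w+τ+1 by ring, hg.2.1, hg.2.2.1, ← mul_assoc, ← Complex.exp_add]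
    congr 2; ring
  unfold ΔRHS at h
  rw [e0, show u+1/2+τ/2+η = (u+η)+1/2+τ/2 by ring, show u+1/2+τ/2-η = (u-η)+1/2+τ/2 by ring,
    e3, e3] at h
  simp only [e1, e2] at h
  unfold σop
  have k0 : Complex.exp (cπ*I*(τ+4*u)) * Complex.exp (-cπ*I*(τ+4*u)) = 1 := by
    rw [← Complex.exp_add, ← Complex.exp_zero]; congr 1; ring
  have kN : Complex.exp (N*(2*cπ*I)) = 1 := by
    rw [Complex.exp_nat_mul, exp_two_pi, one_pow]
  have k1 : Complex.exp (cπ*I*(τ+4*u)) * Complex.exp (2*cπ*I*N*(1/4 + τ/4 + u)) *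
     (Complex.exp (-cπ*I*τ/4 - cπ*I*(u+a₁-N*η/2)) * Complex.exp (-cπ*I*τ/4 - cπ*I*(u+a₂-N*η/2)) *
     Complex.exp (-cπ*I*τ/4 - cπ*I*(u+a₃-N*η/2)) * Complex.exp (-cπ*I*τ/4 - cπ*I*(u+a₄-N*η/2)) *
     Complex.exp (2*cπ*I*N*(1/4+τ/4+(u+η+1/2+τ/2)) - 2*cπ*I*N*(2*(u+η)+τ))) = 1 := by
    simp only [← Complex.exp_add]
    refine Eq.trans ?_ kN; congr 1
    linear_combination (-cπ*I)*ha
  have k2 : Complex.exp (cπ*I*(τ+4*u)) * Complex.exp (2*cπ*I*N*(1/4 + τ/4 + u)) *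
     (Complex.exp (-cπ*I*τ/4 - cπ*I*(u-a₁+N*η/2)) * Complex.exp (-cπ*I*τ/4 - cπ*I*(u-a₂+N*η/2)) *
     Complex.exp (-cπ*I*τ/4 - cπ*I*(u-a₃+N*η/2)) * Complex.exp (-cπ*I*τ/4 - cπ*I*(u-a₄+N*η/2)) *
     Complex.exp (2*cπ*I*N*(1/4+τ/4+(u-η+1/2+τ/2)) - 2*cπ*I*N*(2*(u-η)+τ))) = 1 := by
    simp only [← Complex.exp_add]
    refine Eq.trans ?_ kN; congr 1
    linear_combination (cπ*I)*ha
  linear_combination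
    (-(θf τ (2*u) * (Complex.exp (2*cπ*I*N*(1/4 + τ/4 + u)) * Dg (u+1/2+τ/2)))) * k0 +
    (Complex.exp (cπ*I*(τ+4*u)) * Complex.exp (2*cπ*I*N*(1/4 + τ/4 + u))) * h +
    (Jf τ (u+a₁-N*η/2) * Jf τ (u+a₂-N*η/2) * Jf τ (u+a₃-N*η/2) * Jf τ (u+a₄-N*η/2) * g (u+η)) * k1 -
    (Jf τ (u-a₁+N*η/2) * Jf τ (u-a₂+N*η/2) * Jf τ (u-a₃+N*η/2) * Jf τ (u-a₄+N*η/2) * g (u-η)) * k2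

theorem σD_conj (t s : ℝ) {N : ℕ} {a₁ a₂ a₃ a₄ : ℂ} (ha : a₁+a₂+a₃+a₄ = 0) {g Dg : ℂ → ℂ}
    (hg : ThetaSp (t*I) N g)
    (hD : ∀ x, θf (t*I) (2*x) * Dg x = ΔRHS (t*I) (s*I) N ((starRingEnd ℂ) a₁) ((starRingEnd ℂ) a₂)
        ((starRingEnd ℂ) a₃) ((starRingEnd ℂ) a₄) (σop (t*I) N g) x) (v : ℂ) :
    θf (t*I) (2*v) * gst (σop (t*I) N Dg) v =
    Jf (t*I) (v+a₁+N*(s*I)/2) * Jf (t*I) (v+a₂+N*(s*I)/2) * Jf (t*I) (v+a₃+N*(s*I)/2) *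
      Jf (t*I) (v+a₄+N*(s*I)/2) * gst g (v-s*I) -
    Jf (t*I) (v-a₁-N*(s*I)/2) * Jf (t*I) (v-a₂-N*(s*I)/2) * Jf (t*I) (v-a₃-N*(s*I)/2) *
      Jf (t*I) (v-a₄-N*(s*I)/2) * gst g (v+s*I) := by
  have ha' : (starRingEnd ℂ) a₁ + (starRingEnd ℂ) a₂ + (starRingEnd ℂ) a₃ + (starRingEnd ℂ) a₄ = 0 := by
    rw [← map_add, ← map_add, ← map_add, ha, map_zero]
  have h := congrArg (starRingEnd ℂ) (σD_eq ha' hg hD ((starRingEnd ℂ) v))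
  have e2 : (starRingEnd ℂ) (2:ℂ) = 2 := map_ofNat _ 2
  simp only [map_mul, map_sub, θ_conj, J_conj, Complex.conj_conj, map_add, map_div₀, conj_I,
    conj_ofReal, map_natCast, e2] at h
  unfold gst
  simp only [map_sub, map_add, map_mul, conj_I, conj_ofReal]
  rw [h]
  have e3 : ∀ a, v+a-N*(s*(-I))/2 = v+a+N*(s*I)/2 := by intro a; ring
  have e4 : ∀ a, v-a+N*(s*(-I))/2 = v-a-N*(s*I)/2 := by intro a; ring
  simp only [e3, e4]
  rw [show (starRingEnd ℂ) v - s*(-I) = (starRingEnd ℂ) v + s*I by ring,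
    show (starRingEnd ℂ) v + s*(-I) = (starRingEnd ℂ) v - s*I by ring]
/-- For η ∈ 𝕀_N, the adjoint of Δ(a) with respect to the Sklyanin
pairing is σ∘Δ(ā)∘σ. -/
theorem sklyanin_adjoint_imaginary
    (t : ℝ) (ht : 0 < t) (τ : ℂ) (hτ : τ = t * I)
    (N : ℕ) (s : ℝ) (η : ℂ) (hη : η = (s : ℂ) * I) (hs : |s| < t / (2 * (N + 1)))
    (a₁ a₂ a₃ a₄ : ℂ) (ha : a₁ + a₂ + a₃ + a₄ = 0)
    (f g : ℂ → ℂ) (hf : ThetaSp τ N f) (hg : ThetaSp τ N g)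
    (Df : ℂ → ℂ) (hDf : Differentiable ℂ Df)
    (hDfEq : ∀ x, θf τ (2*x) * Df x = ΔRHS τ η N a₁ a₂ a₃ a₄ f x)
    (Dg : ℂ → ℂ) (hDg : Differentiable ℂ Dg)
    (hDgEq : ∀ x, θf τ (2*x) * Dg x =
      ΔRHS τ η N ((starRingEnd ℂ) a₁) ((starRingEnd ℂ) a₂)
        ((starRingEnd ℂ) a₃) ((starRingEnd ℂ) a₄) (σop τ N g) x) :
    pairing τ η t N Df g = pairing τ η t N f (σop τ N Dg) := by
  subst hτ hη
  have hs' : (N+1)*|s| < t/2 := by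
    have hN : (0:ℝ) < N+1 := by positivity
    rw [lt_div_iff₀ (by positivity)] at hs
    linarith
  have hgs := gst_theta hg
  have D := dbl t s ht N hs' a₁ a₂ a₃ a₄ ha f (gst g) hf hgs
  have ec : ∀ x y : ℝ, (starRingEnd ℂ) ((x:ℂ) + y*I) = x - y*I := by
    intro x y; simp; ring
  have eg : ∀ (k : ℂ → ℂ) (x y : ℝ), (starRingEnd ℂ) (k (x + y*I)) = gst k (x - y*I) := by
    intro k x y
    unfold gst
    rw [← ec, Complex.conj_conj]
  have L : ∀ x y : ℝ, Df (x + y*I) * (starRingEnd ℂ) (g (x + y*I)) *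
      Mw (t*I) (s*I) N (x + y*I) ((starRingEnd ℂ) (x + y*I)) =
      Complex.exp (cπ*I*(t*I)*(N+2)/2) * (T1 (t*I) (s*I) N a₁ a₂ a₃ a₄ f (gst g) x (y*I) -
      T1 (t*I) (-(s*I)) N (-a₁) (-a₂) (-a₃) (-a₄) f (gst g) x (y*I)) := by
    intro x y
    rw [ec, eg, Mw_eq]
    have h := hDfEq (x+y*I)
    unfold ΔRHS at h
    unfold T1
    rw [den_neg, den_neg]
    have e1 : ∀ a, (x:ℂ)+y*I+ -a-N*(-(s*I))/2 = x+y*I-a+N*(s*I)/2 := by intro a; ring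
    simp only [e1]
    rw [← sub_eq_add_neg]
    linear_combination (Complex.exp (cπ*I*(t*I)*(N+2)/2) * gst g (x-y*I) * θf (t*I) (2*(x-y*I)) /
      (den (t*I) (s*I) N x * den (t*I) (s*I) N (y*I))) * h
  have R : ∀ x y : ℝ, f (x + y*I) * (starRingEnd ℂ) (σop (t*I) N Dg (x + y*I)) *
      Mw (t*I) (s*I) N (x + y*I) ((starRingEnd ℂ) (x + y*I)) =
      Complex.exp (cπ*I*(t*I)*(N+2)/2) *
      (T4 (t*I) (-(s*I)) N (-a₁) (-a₂) (-a₃) (-a₄) f (gst g) x (y*I) -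
      T4 (t*I) (s*I) N a₁ a₂ a₃ a₄ f (gst g) x (y*I)) := by
    intro x y
    rw [ec, eg, Mw_eq]
    have h := σD_conj t s ha hg hDgEq (x-y*I)
    unfold T4
    rw [den_neg, den_neg]
    have e1 : ∀ a, (x:ℂ)-y*I- -a-N*(-(s*I))/2 = x-y*I+a+N*(s*I)/2 := by intro a; ring
    simp only [e1]
    rw [← sub_eq_add_neg]
    linear_combination (Complex.exp (cπ*I*(t*I)*(N+2)/2) * f (x+y*I) * θf (t*I) (2*(x+y*I)) /
      (den (t*I) (s*I) N x * den (t*I) (s*I) N (y*I))) * h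
  unfold pairing
  simp only [L, R, intervalIntegral.integral_const_mul]
  rw [D]
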